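/- Let α ∈ (0,1), let 0 < α' < α, let N = ⌊1/α'⌋, and let Γ : ℝ → ℝ^d be a compactly supported α-Hölder path. Then there exist (a) a family Γ^n_{ts}(i_1,…,i_n) (1 ≤ n ≤ N, words in {1,…,d}^n, s,t ∈ ℝ) with Γ^1_{ts}(i) = Γ_t(i) − Γ_s(i), satisfying the nα'-Hölder bounds sup_{s≠t} |Γ^n_{ts}(i_1,…,i_n)|/|t−s|^{nα'} < ∞, the Chen property Γ^n_{ts} − Γ^n_{tu} − Γ^n_{us} = Σ_{k=1}^{n−1} Γ^k_{tu}(i_1,…,i_k)Γ^{n−k}_{us}(i_{k+1},…,i_n), and the shuffle property Γ^{n_1}_{ts}(i⃗)Γ^{n_2}_{ts}(j⃗) = Σ_S Γ^{n_1+n_2}_{ts}(k^S) for n_1+n_2 ≤ N; and (b) a sequence of continuously differentiable compactly supported paths Γ^{(m)} : ℝ → ℝ^d such that for every n ≤ N and every word (i_1,…,i_n), sup_{s≠t} |Γ^{(m),cano,n}_{ts}(i_1,…,i_n) − Γ^n_{ts}(i_1,…,i_n)| / |t−s|^{nα'} → 0 as m → ∞, where Γ^{(m),cano} denotes the canonical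 lift of Γ^{(m)}. -/

import Mathlib

/-- The word of length `n₁ + n₂` obtained by placing the letters of `u` in order at the
positions of `S` and the letters of `v` in order at the remaining positions. -/
noncomputable def shuffleWord {d n₁ n₂ : ℕ} (u : Fin n₁ → Fin d) (v : Fin n₂ → Fin d)
    (S : Finset (Fin (n₁ + n₂))) (hS : S.card = n₁) (m : Fin (n₁ + n₂)) : Fin d :=
  if hm : m ∈ S then u ((S.orderIsoOfFin hS).symm ⟨m, hm⟩)
  else v ((Sᶜ.orderIsoOfFin (by rw [Finset.card_compl, hS, Fintype.card_fin]; omega)).symm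
      ⟨m, Finset.mem_compl.mpr hm⟩)

/-- The canonical lift of a path `Γ : ℝ → ℝ^d`: the nested iterated integrals
`Γ^{cano,n}_{ts}(i₁,…,iₙ) = ∫_s^t Γ'(i₁)(x₁) ∫_s^{x₁} Γ'(i₂)(x₂) ⋯ dx₂ dx₁`. -/
noncomputable def canoLift {d : ℕ} (Γ : ℝ → Fin d → ℝ) :
    (n : ℕ) → (Fin n → Fin d) → ℝ → ℝ → ℝ
  | 0, _, _, _ => 1
  | n + 1, w, t, s =>
      ∫ x in s..t, deriv (fun y => Γ y (w 0)) x * canoLift Γ n (fun j => w j.succ) x s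

/-- Iterated integrals of the velocity field `f` along a word, the first letter being the
outermost integration variable. -/
noncomputable def iterInt {d : ℕ} (f : ℝ → Fin d → ℝ) : List (Fin d) → ℝ → ℝ → ℝ
  | [], _, _ => 1
  | i :: w, t, s => ∫ x in s..t, f x i * iterInt f w x s

/-- The convolution product on functions of words dual to deconcatenation. -/
noncomputable def chenMul {d : ℕ} (g h : List (Fin d) → ℝ) (w : List (Fin d)) : ℝ :=
  ∑ k ∈ Finset.range (w.length + 1), g (w.take k) * h (w.drop k)

section IteratedIntegrals

variable {d : ℕ} {f : ℝ → Fin d → ℝ}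

@[simp] lemma iterInt_nil (t s : ℝ) : iterInt f [] t s = 1 := by simp [iterInt]

lemma iterInt_cons (i : Fin d) (w : List (Fin d)) (t s : ℝ) :
    iterInt f (i :: w) t s = ∫ x in s..t, f x i * iterInt f w x s := by rw [iterInt]

lemma continuous_iterInt (hf : Continuous f) (w : List (Fin d)) (s : ℝ) :
    Continuous fun t => iterInt f w t s := by
  induction w with
  | nil => simpa using continuous_const
  | cons i w ih =>
    simp only [iterInt_cons]
    exact intervalIntegral.continuous_primitive
      (fun a b => Continuous.intervalIntegrable (by fun_prop) a b) s

lemma hasDerivAt_iterInt_cons (hf : Continuous f) (i : Fin d) (w : List (Fin d)) (t s : ℝ) :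
    HasDerivAt (fun t => iterInt f (i :: w) t s) (f t i * iterInt f w t s) t := by
  simp only [iterInt_cons]
  have h : Continuous fun x => f x i * iterInt f w x s := by
    have := continuous_iterInt hf w s
    fun_prop
  exact intervalIntegral.integral_hasDerivAt_right (h.intervalIntegrable _ _)
    (h.stronglyMeasurableAtFilter _ _) h.continuousAt

lemma iterInt_self_cons (i : Fin d) (w : List (Fin d)) (s : ℝ) : iterInt f (i :: w) s s = 0 := by
  simp [iterInt_cons]

lemma iterInt_self (w : List (Fin d)) (hw : w ≠ []) (s : ℝ) : iterInt f w s s = 0 := by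
  cases w with
  | nil => exact absurd rfl hw
  | cons i w => exact iterInt_self_cons i w s

lemma chenMul_nil (g h : List (Fin d) → ℝ) : chenMul g h [] = g [] * h [] := by simp [chenMul]

lemma chenMul_cons (g h : List (Fin d) → ℝ) (i : Fin d) (w : List (Fin d)) :
    chenMul g h (i :: w) = chenMul (fun v => g (i :: v)) h w + g [] * h (i :: w) := by
  simp [chenMul, Finset.sum_range_succ' _ (w.length + 1)]

/-- Chen's relation for iterated integrals. -/
theorem iterInt_chen (hf : Continuous f) (w : List (Fin d)) (t u s : ℝ) :
    iterInt f w t s = chenMul (fun v => iterInt f v t u) (fun v => iterInt f v u s) w := by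
  induction w generalizing t with
  | nil => simp [chenMul_nil]
  | cons i w ih =>
    have hc : ∀ (v : List (Fin d)) (r : ℝ), Continuous fun x => f x i * iterInt f v x r :=
      fun v r => by
        have := continuous_iterInt hf v r
        fun_prop
    rw [chenMul_cons, iterInt_cons, iterInt_nil, one_mul, iterInt_cons i w u s,
      ← intervalIntegral.integral_add_adjacent_intervals
        ((hc w s).intervalIntegrable s u) ((hc w s).intervalIntegrable u t), add_comm]
    congr 1
    simp only [ih, chenMul, Finset.mul_sum, iterInt_cons]
    rw [intervalIntegral.integral_finsetSum]
    · refine Finset.sum_congr rfl fun k _ => ?_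
      rw [← intervalIntegral.integral_mul_const]
      simp only [mul_assoc]
    · intro k _
      simp only [← mul_assoc]
      exact ((hc _ u).mul_const _).intervalIntegrable _ _

lemma iterInt_congr {h : ℝ → Fin d → ℝ} (w : List (Fin d)) {t s : ℝ}
    (hfh : ∀ x ∈ Set.uIcc s t, f x = h x) : iterInt f w t s = iterInt h w t s := by
  induction w generalizing t with
  | nil => simp
  | cons i w ih =>
    simp only [iterInt_cons]
    refine intervalIntegral.integral_congr fun x hx => ?_
    rw [hfh x hx, ih fun y hy => hfh y (Set.uIcc_subset_uIcc_left hx hy)]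

lemma iterInt_comp_affine (a b : ℝ) (w : List (Fin d)) (t s : ℝ) :
    iterInt (fun x => a • f (a * x + b)) w t s = iterInt f w (a * t + b) (a * s + b) := by
  induction w generalizing t with
  | nil => simp
  | cons i w ih =>
    rw [iterInt_cons, iterInt_cons]
    simp_rw [ih]
    rw [← intervalIntegral.smul_integral_comp_mul_add
      (fun x => f x i * iterInt f w x (a * s + b)), smul_eq_mul,
      ← intervalIntegral.integral_const_mul]
    simp [mul_assoc]

lemma iterInt_smul (c : ℝ) (w : List (Fin d)) (t s : ℝ) :
    iterInt (fun x => c • f x) w t s = c ^ w.length * iterInt f w t s := by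
  induction w generalizing t with
  | nil => simp
  | cons i w ih =>
    simp only [iterInt_cons, ih, ← intervalIntegral.integral_const_mul]
    refine intervalIntegral.integral_congr fun x _ => ?_
    simp only [Pi.smul_apply, smul_eq_mul, List.length_cons]
    ring

lemma iterInt_zero (w : List (Fin d)) (hw : w ≠ []) (t s : ℝ) :
    iterInt (0 : ℝ → Fin d → ℝ) w t s = 0 := by
  cases w with
  | nil => exact absurd rfl hw
  | cons i w => simp [iterInt_cons]

lemma abs_iterInt_le {L : ℝ} (hL : ∀ x, ‖f x‖ ≤ L) (w : List (Fin d)) (t s : ℝ) :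
    |iterInt f w t s| ≤ (L * |t - s|) ^ w.length := by
  have hL0 : 0 ≤ L := (norm_nonneg _).trans (hL 0)
  induction w generalizing t with
  | nil => simp
  | cons i w ih =>
    rw [iterInt_cons, List.length_cons, pow_succ', ← Real.norm_eq_abs, mul_right_comm]
    refine intervalIntegral.norm_integral_le_of_norm_le_const fun x hx => ?_
    rw [norm_mul]
    refine mul_le_mul ((norm_le_pi_norm (f x) i).trans (hL x)) ?_ (norm_nonneg _) hL0
    refine (ih x).trans ?_
    have : |x - s| ≤ |t - s| := Set.abs_sub_left_of_mem_uIcc (Set.uIoc_subset_uIcc hx)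
    gcongr

/-- A path which runs back along itself has trivial iterated integrals. -/
lemma iterInt_palindrome (hf : Continuous f) {c : ℝ} (hsymm : ∀ x, f (c - x) = -f x)
    (w : List (Fin d)) (t s : ℝ) : iterInt f w (c - t) s = iterInt f w t s := by
  induction w generalizing t with
  | nil => simp
  | cons i w ih =>
    have h1 : ∀ y, HasDerivAt (fun y => iterInt f (i :: w) (c - y) s)
        (f y i * iterInt f w y s) y := fun y => by
      refine HasDerivAt.congr_deriv ((hasDerivAt_iterInt_cons hf i w (c - y) s).comp y
        ((hasDerivAt_id y).const_sub c)) ?_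
      rw [ih, hsymm]
      simp
    have h2 : ∀ y, HasDerivAt
        (fun y => iterInt f (i :: w) (c - y) s - iterInt f (i :: w) y s) 0 y := fun y =>
      ((h1 y).sub (hasDerivAt_iterInt_cons hf i w y s)).congr_deriv (sub_self _)
    have h3 := is_const_of_deriv_eq_zero (fun y => (h2 y).differentiableAt)
      (fun y => (h2 y).deriv) t (c / 2)
    simp only [sub_half, sub_self] at h3
    linarith

end IteratedIntegrals

section Shuffle

/-- The interleaving of two infinite words prescribed by a list of booleans. -/
def interleave {A : Type*} : (ℕ → A) → (ℕ → A) → List Bool → List A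
  | _, _, [] => []
  | u, v, true :: b => u 0 :: interleave (fun k => u (k + 1)) v b
  | u, v, false :: b => v 0 :: interleave u (fun k => v (k + 1)) b

lemma interleave_ofFn {A : Type*} {n : ℕ} (u v : ℕ → A) (b : Fin n → Bool) :
    interleave u v (List.ofFn b) = List.ofFn fun m : Fin n =>
      if b m = true then u (Finset.univ.filter fun j => j < m ∧ b j = true).card
      else v (Finset.univ.filter fun j => j < m ∧ b j = false).card := by
  induction n generalizing u v with
  | zero => simp [interleave]
  | succ n ih =>
    rw [List.ofFn_succ, List.ofFn_succ]
    cases hb : b 0 <;>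
    · simp only [interleave, ih]
      simp [hb, Fin.card_filter_univ_succ]

lemma sum_fin_succ_bool (n k : ℕ) (F : (Fin (n + 1) → Bool) → ℝ) :
    ∑ b : Fin (n + 1) → Bool with (Finset.univ.filter fun i => b i = true).card = k, F b =
      (∑ b : Fin n → Bool with (Finset.univ.filter fun i => b i = true).card + 1 = k,
        F (Fin.cons true b)) +
      ∑ b : Fin n → Bool with (Finset.univ.filter fun i => b i = true).card = k,
        F (Fin.cons false b) := by
  have hc : ∀ (x : Bool) (b : Fin n → Bool),
      (Finset.univ.filter fun i => (Fin.cons x b : Fin (n + 1) → Bool) i = true).card =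
        if x then (Finset.univ.filter fun i => b i = true).card + 1
        else (Finset.univ.filter fun i => b i = true).card := fun x b => by
    rw [Fin.card_filter_univ_succ fun i => (Fin.cons x b : Fin (n + 1) → Bool) i = true]
    simp
  simp only [Finset.sum_filter]
  rw [← (Fin.consEquiv (fun _ => Bool)).sum_comp, Fintype.sum_prod_type, Fintype.sum_bool]
  exact congrArg₂ (· + ·)
    (Finset.sum_congr rfl fun b _ =>
      if_congr (iff_of_eq (congrArg (· = k) (hc true b))) rfl rfl)
    (Finset.sum_congr rfl fun b _ =>
      if_congr (iff_of_eq (congrArg (· = k) (hc false b))) rfl rfl)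

lemma eq_of_hasDerivAt_eq {F G F' : ℝ → ℝ} (hF : ∀ y, HasDerivAt F (F' y) y)
    (hG : ∀ y, HasDerivAt G (F' y) y) (s t : ℝ) (h : F s = G s) : F t = G t := by
  have h2 : ∀ y, HasDerivAt (fun y => F y - G y) 0 y := fun y =>
    ((hF y).sub (hG y)).congr_deriv (sub_self _)
  have h3 := is_const_of_deriv_eq_zero (fun y => (h2 y).differentiableAt)
    (fun y => (h2 y).deriv) t s
  simp only [h, sub_self] at h3
  linarith

/-- The shuffle relation for iterated integrals. -/
theorem iterInt_shuffle {d : ℕ} {f : ℝ → Fin d → ℝ} (hf : Continuous f) (n n₁ n₂ : ℕ)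
    (hn : n₁ + n₂ = n) (u v : ℕ → Fin d) (t s : ℝ) :
    iterInt f (List.ofFn fun i : Fin n₁ => u i) t s *
        iterInt f (List.ofFn fun i : Fin n₂ => v i) t s =
      ∑ b : Fin n → Bool with (Finset.univ.filter fun i => b i = true).card = n₁,
        iterInt f (interleave u v (List.ofFn b)) t s := by
  induction n generalizing n₁ n₂ u v t with
  | zero =>
    obtain ⟨rfl, rfl⟩ : n₁ = 0 ∧ n₂ = 0 := by omega
    simp [interleave]
  | succ n ih =>
    rw [sum_fin_succ_bool]
    simp only [List.ofFn_cons, interleave]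
    refine eq_of_hasDerivAt_eq (F := fun t => iterInt f (List.ofFn fun i : Fin n₁ => u i) t s *
        iterInt f (List.ofFn fun i : Fin n₂ => v i) t s) (G := fun t =>
      (∑ b : Fin n → Bool with (Finset.univ.filter fun i => b i = true).card + 1 = n₁,
        iterInt f (u 0 :: interleave (fun k => u (k + 1)) v (List.ofFn b)) t s) +
      ∑ b : Fin n → Bool with (Finset.univ.filter fun i => b i = true).card = n₁,
        iterInt f (v 0 :: interleave u (fun k => v (k + 1)) (List.ofFn b)) t s) (F' := fun t =>
      (∑ b : Fin n → Bool with (Finset.univ.filter fun i => b i = true).card + 1 = n₁,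
        f t (u 0) * iterInt f (interleave (fun k => u (k + 1)) v (List.ofFn b)) t s) +
      ∑ b : Fin n → Bool with (Finset.univ.filter fun i => b i = true).card = n₁,
        f t (v 0) * iterInt f (interleave u (fun k => v (k + 1)) (List.ofFn b)) t s)
      (fun y => ?_) (fun y => ?_) s t ?_
    · simp only [← Finset.mul_sum]
      rcases n₁ with _ | n₁
      · obtain rfl : n₂ = n + 1 := by omega
        rw [← ih 0 n (by omega) u]
        simpa [List.ofFn_succ] using hasDerivAt_iterInt_cons hf _ _ _ _
      rcases n₂ with _ | n₂
      · obtain rfl : n₁ = n := by omega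
        have hE : (Finset.univ.filter fun b : Fin n₁ → Bool =>
            (Finset.univ.filter fun i => b i = true).card = n₁ + 1) = ∅ := by
          refine Finset.filter_false_of_mem fun b _ h => ?_
          have := (Finset.univ.filter fun i => b i = true).card_le_univ
          simp only [Fintype.card_fin] at this
          omega
        simp only [Nat.add_right_cancel_iff]
        rw [hE, ← ih n₁ 0 (by omega) _ v]
        simpa [List.ofFn_succ] using hasDerivAt_iterInt_cons hf _ _ _ _
      · simp only [Nat.add_right_cancel_iff]
        rw [← ih n₁ (n₂ + 1) (by omega), ← ih (n₁ + 1) n₂ (by omega)]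
        simp only [List.ofFn_succ (n := n₁), List.ofFn_succ (n := n₂)]
        refine ((hasDerivAt_iterInt_cons hf _ _ _ _).mul
          (hasDerivAt_iterInt_cons hf _ _ _ _)).congr_deriv ?_
        simp only [Fin.val_zero, Fin.val_succ]
        ring
    · exact (HasDerivAt.fun_sum fun b _ => hasDerivAt_iterInt_cons hf _ _ _ _).add
        (HasDerivAt.fun_sum fun b _ => hasDerivAt_iterInt_cons hf _ _ _ _)
    · simp only [iterInt_self_cons, Finset.sum_const_zero, add_zero, mul_eq_zero]
      rcases n₁ with _ | n₁
      · right
        exact iterInt_self _ (by simp; omega) _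
      · left
        exact iterInt_self _ (by simp) _

lemma orderIsoOfFin_symm_val {n k : ℕ} (S : Finset (Fin n)) (hS : S.card = k) (m : Fin n)
    (hm : m ∈ S) : ((S.orderIsoOfFin hS).symm ⟨m, hm⟩ : ℕ) =
      (Finset.univ.filter fun j => j < m ∧ j ∈ S).card := by
  set e := S.orderIsoOfFin hS
  rw [← Fin.card_Iio (e.symm ⟨m, hm⟩)]
  refine Finset.card_bij (fun a _ => (e a : Fin n)) (fun a ha => ?_) (fun a _ b _ h => ?_)
    (fun b hb => ?_)
  · rw [Finset.mem_Iio, OrderIso.lt_symm_apply] at ha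
    exact Finset.mem_filter.2 ⟨Finset.mem_univ _, ha, (e a).2⟩
  · exact e.injective (Subtype.ext h)
  · simp only [Finset.mem_filter, Finset.mem_univ, true_and] at hb
    refine ⟨e.symm ⟨b, hb.2⟩, ?_, by simp⟩
    rw [Finset.mem_Iio, OrderIso.lt_iff_lt]
    exact hb.1

lemma ofFn_shuffleWord {d n₁ n₂ : ℕ} (u v : ℕ → Fin d) (S : Finset (Fin (n₁ + n₂)))
    (hS : S.card = n₁) :
    List.ofFn (shuffleWord (fun i : Fin n₁ => u i) (fun i : Fin n₂ => v i) S hS) =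
      interleave u v (List.ofFn fun m => decide (m ∈ S)) := by
  rw [interleave_ofFn]
  congr 1
  ext1 m
  unfold shuffleWord
  by_cases hm : m ∈ S
  · simp only [hm, dite_true, decide_true, if_true, orderIsoOfFin_symm_val, decide_eq_true_eq]
  · simp only [hm, dite_false, decide_false, orderIsoOfFin_symm_val, decide_eq_true_eq,
      decide_eq_false_iff_not, Finset.mem_compl, Bool.false_eq_true, if_false]

/-- The shuffle relation for iterated integrals, indexed by subsets of positions. -/
theorem iterInt_shuffleWord {d : ℕ} {f : ℝ → Fin d → ℝ} (hf : Continuous f) {n₁ n₂ : ℕ}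
    (u : Fin n₁ → Fin d) (v : Fin n₂ → Fin d) (t s : ℝ) :
    iterInt f (List.ofFn u) t s * iterInt f (List.ofFn v) t s =
      ∑ S : {S : Finset (Fin (n₁ + n₂)) // S.card = n₁},
        iterInt f (List.ofFn (shuffleWord u v S.1 S.2)) t s := by
  rcases Nat.eq_zero_or_pos d with rfl | hd
  · rcases n₁ with _ | n₁
    · rcases n₂ with _ | n₂
      · have : Unique {S : Finset (Fin (0 + 0)) // S.card = 0} :=
          ⟨⟨⟨∅, rfl⟩⟩, fun S => Subtype.ext (Finset.card_eq_zero.1 S.2)⟩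
        rw [Fintype.sum_unique]
        simp
      · exact (v 0).elim0
    · exact (u 0).elim0
  have extend : ∀ {n : ℕ} (w : Fin n → Fin d), ∃ w' : ℕ → Fin d, w = fun i : Fin n => w' i := fun {n} w =>
    ⟨fun k => if h : k < n then w ⟨k, h⟩ else ⟨0, hd⟩, by ext1 i; simp⟩
  obtain ⟨u, rfl⟩ := extend u
  obtain ⟨v, rfl⟩ := extend v
  rw [iterInt_shuffle hf (n₁ + n₂) n₁ n₂ rfl u v]
  simp only [ofFn_shuffleWord]
  rw [← Finset.sum_subtype_eq_sum_filter]
  refine (Finset.sum_bij (fun S _ => ⟨fun m => decide (m ∈ S.1), by simpa using S.2⟩)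
    (fun S _ => by simp) (fun S _ T _ h => ?_) (fun b hb => ?_) (fun S _ => rfl)).symm
  · have := congrArg Subtype.val h
    ext m
    simpa using congrFun this m
  · refine ⟨⟨Finset.univ.filter fun i => b.1 i = true, b.2⟩, Finset.mem_univ _, ?_⟩
    ext m
    simp

end Shuffle

lemma canoLift_eq_iterInt {d n : ℕ} (Γ : ℝ → Fin d → ℝ) (w : Fin n → Fin d) (t s : ℝ) :
    canoLift Γ n w t s =
      iterInt (fun x i => deriv (fun y => Γ y i) x) (List.ofFn w) t s := by
  induction n generalizing t with
  | zero => simp [canoLift]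
  | succ n ih => simp [canoLift, List.ofFn_succ, iterInt_cons, ih]

section Reachable

variable {d : ℕ}

lemma chenMul_congr {g g' h h' : List (Fin d) → ℝ} {w : List (Fin d)}
    (hg : ∀ v : List (Fin d), v.length ≤ w.length → g v = g' v)
    (hh : ∀ v : List (Fin d), v.length ≤ w.length → h v = h' v) :
    chenMul g h w = chenMul g' h' w :=
  Finset.sum_congr rfl fun k _ => by rw [hg _ (by simp), hh _ (by simp)]

/-- Perturbing both factors in top degree only perturbs the product additively. -/
lemma chenMul_sub_chenMul {g g' h h' : List (Fin d) → ℝ} {w : List (Fin d)} (hw : w ≠ [])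
    (hg : ∀ v : List (Fin d), v.length < w.length → g' v = g v)
    (hh : ∀ v : List (Fin d), v.length < w.length → h' v = h v) :
    chenMul g' h' w - chenMul g h w = (g' w - g w) * h [] + g [] * (h' w - h w) := by
  obtain ⟨n, hn⟩ : ∃ n, w.length = n + 1 :=
    Nat.exists_eq_succ_of_ne_zero (by simpa using hw)
  have hmid : ∀ k ∈ Finset.range n, g' (w.take (k + 1)) * h' (w.drop (k + 1)) =
      g (w.take (k + 1)) * h (w.drop (k + 1)) := fun k hk => by
    rw [Finset.mem_range] at hk
    rw [hg _ (by simp; omega), hh _ (by simp; omega)]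
  unfold chenMul
  rw [hn, Finset.sum_range_succ, Finset.sum_range_succ', Finset.sum_congr rfl hmid,
    Finset.sum_range_succ _ (n + 1), Finset.sum_range_succ' _ n, ← hn]
  simp only [List.take_length, List.drop_length, List.take_zero, List.drop_zero]
  rw [hg [] (by simp; omega), hh [] (by simp; omega)]
  ring

/-- `g` is the family of iterated integrals of a path on the unit interval with continuous
velocity of size at most `L`, vanishing at the end points. -/
def Reachable (L : ℝ) (g : List (Fin d) → ℝ) : Prop :=
  ∃ f : ℝ → Fin d → ℝ, Continuous f ∧ (∀ x, x ∉ Set.Ioo (0 : ℝ) 1 → f x = 0) ∧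
    (∀ x, ‖f x‖ ≤ L) ∧ ∀ w, iterInt f w 1 0 = g w

variable {L L' : ℝ} {g h : List (Fin d) → ℝ}

lemma Reachable.nonneg (hg : Reachable L g) : 0 ≤ L := by
  obtain ⟨f, -, -, hL, -⟩ := hg
  exact (norm_nonneg _).trans (hL 0)

lemma Reachable.nil (hg : Reachable L g) : g [] = 1 := by
  obtain ⟨f, -, -, -, h⟩ := hg
  rw [← h, iterInt_nil]

lemma Reachable.abs_le (hg : Reachable L g) (w : List (Fin d)) : |g w| ≤ L ^ w.length := by
  obtain ⟨f, -, -, hL, h⟩ := hg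
  simpa [h] using abs_iterInt_le hL w 1 0

lemma Reachable.mono (hg : Reachable L g) (hL : L ≤ L') : Reachable L' g := by
  obtain ⟨f, h1, h2, h3, h4⟩ := hg
  exact ⟨f, h1, h2, fun x => (h3 x).trans hL, h4⟩

lemma reachable_one : Reachable 0 (fun w : List (Fin d) => if w = [] then 1 else 0) := by
  refine ⟨0, continuous_zero, fun _ _ => rfl, fun _ => by simp, fun w => ?_⟩
  by_cases hw : w = []
  · simp [hw]
  · simp only [hw, if_false]
    exact iterInt_zero w hw _ _

lemma Reachable.dilate (hg : Reachable L g) (c : ℝ) :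
    Reachable (|c| * L) (fun w => c ^ w.length * g w) := by
  obtain ⟨f, h1, h2, h3, h4⟩ := hg
  refine ⟨fun x => c • f x, h1.const_smul c, fun x hx => by simp [h2 x hx], fun x => ?_,
    fun w => by rw [iterInt_smul, h4]⟩
  rw [norm_smul, Real.norm_eq_abs]
  exact mul_le_mul_of_nonneg_left (h3 x) (abs_nonneg c)

/-- The velocity of the path which first follows `f`, then `e`. -/
def concatVelocity (e f : ℝ → Fin d → ℝ) (x : ℝ) : Fin d → ℝ :=
  (2 : ℝ) • e (2 * x + -1) + (2 : ℝ) • f (2 * x + 0)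

lemma continuous_concatVelocity {e f : ℝ → Fin d → ℝ} (he : Continuous e) (hf : Continuous f) :
    Continuous (concatVelocity e f) := by
  unfold concatVelocity
  fun_prop

lemma iterInt_concatVelocity {e f : ℝ → Fin d → ℝ} (he : Continuous e) (hf : Continuous f)
    (he0 : ∀ x, x ∉ Set.Ioo (0 : ℝ) 1 → e x = 0) (hf0 : ∀ x, x ∉ Set.Ioo (0 : ℝ) 1 → f x = 0)
    (w : List (Fin d)) :
    iterInt (concatVelocity e f) w 1 0 =
      chenMul (fun v => iterInt e v 1 0) (fun v => iterInt f v 1 0) w := by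
  rw [iterInt_chen (continuous_concatVelocity he hf) w 1 (1 / 2) 0]
  refine chenMul_congr (fun v _ => ?_) fun v _ => ?_
  · rw [iterInt_congr (h := fun x => (2 : ℝ) • e (2 * x + -1)), iterInt_comp_affine]
    · norm_num
    · intro x hx
      rw [Set.uIcc_of_le (by norm_num)] at hx
      simp [concatVelocity, hf0 (2 * x) fun h => by linarith [hx.1, h.2]]
  · rw [iterInt_congr (h := fun x => (2 : ℝ) • f (2 * x + 0)), iterInt_comp_affine]
    · norm_num
    · intro x hx
      rw [Set.uIcc_of_le (by norm_num)] at hx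
      simp [concatVelocity, he0 (2 * x + -1) fun h => by linarith [hx.2, h.1]]

lemma Reachable.chenMul (hg : Reachable L g) (hh : Reachable L' h) :
    Reachable (2 * (L + L')) (chenMul g h) := by
  obtain ⟨e, e1, e2, e3, e4⟩ := hg
  obtain ⟨f, f1, f2, f3, f4⟩ := hh
  refine ⟨concatVelocity e f, continuous_concatVelocity e1 f1, fun x hx => ?_, fun x => ?_,
    fun w => ?_⟩
  · rw [concatVelocity, e2 _ fun h => hx ⟨by linarith [h.1], by linarith [h.2]⟩,
      f2 _ fun h => hx ⟨by linarith [h.1], by linarith [h.2]⟩]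
    simp
  · refine (norm_add_le _ _).trans ?_
    simp only [norm_smul, Real.norm_ofNat]
    linarith [e3 (2 * x + -1), f3 (2 * x + 0)]
  · rw [iterInt_concatVelocity e1 f1 e2 f2]
    exact chenMul_congr (fun v _ => e4 v) fun v _ => f4 v

/-- The inverse for the convolution product is reached by running the path backwards. -/
lemma Reachable.exists_inv (hg : Reachable L g) :
    ∃ g', Reachable L g' ∧ ∀ w, w ≠ [] → _root_.chenMul g' g w = 0 := by
  obtain ⟨f, f1, f2, f3, f4⟩ := hg
  set e : ℝ → Fin d → ℝ := fun x => -f (1 - x) with he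
  have e1 : Continuous e := by fun_prop
  have e2 : ∀ x, x ∉ Set.Ioo (0 : ℝ) 1 → e x = 0 := fun x hx => by
    simp [he, f2 (1 - x) fun h => hx ⟨by linarith [h.2], by linarith [h.1]⟩]
  refine ⟨fun w => iterInt e w 1 0, ⟨e, e1, e2, fun x => by simpa [he] using f3 _, fun w => rfl⟩,
    fun w hw => ?_⟩
  have h := iterInt_palindrome (continuous_concatVelocity e1 f1) (c := 1) (fun x => ?_) w 0 0
  · rw [sub_zero, iterInt_self _ hw, iterInt_concatVelocity e1 f1 e2 f2] at h
    refine Eq.trans ?_ h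
    exact chenMul_congr (fun v _ => rfl) fun v _ => (f4 v).symm
  · simp only [concatVelocity, he]
    rw [show (1 : ℝ) - (2 * (1 - x) + -1) = 2 * x + 0 by ring,
      show 2 * (1 - x) + 0 = (1 : ℝ) - (2 * x + -1) by ring]
    simp [add_comm]

/-- `z` is the degree `n` part of a reachable element whose degrees `1, …, n - 1` vanish. -/
def ReachableTop (n : ℕ) (L : ℝ) (z : (Fin n → Fin d) → ℝ) : Prop :=
  ∃ g, Reachable L g ∧ (∀ w : List (Fin d), w ≠ [] → w.length < n → g w = 0) ∧
    ∀ v : Fin n → Fin d, g (List.ofFn v) = z v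

variable {n : ℕ} {z z' : (Fin n → Fin d) → ℝ}

lemma chenMul_of_vanishing (hg1 : g [] = 1)
    (hg : ∀ w : List (Fin d), w ≠ [] → w.length < n → g w = 0) (w : List (Fin d))
    (hw : w ≠ []) (hwn : w.length ≤ n) : chenMul g h w = g w * h [] + h w := by
  have h1 := chenMul_sub_chenMul (g := fun w => if w = [] then 1 else 0) (g' := g) (h := h)
    (h' := h) hw (fun v hv => ?_) fun v _ => rfl
  · have h2 : chenMul (fun w : List (Fin d) => if w = [] then 1 else 0) h w = h w := by
      unfold chenMul
      rw [Finset.sum_eq_single 0]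
      · simp
      · intro k _ hk
        simp [hw, hk]
      · simp
    simp only [h2, hw, if_false, sub_zero, sub_self, mul_zero, add_zero] at h1
    linarith
  · split_ifs with hv0
    · rw [hv0, hg1]
    · exact hg v hv0 (hv.trans_le hwn)

lemma ReachableTop.mono (hz : ReachableTop n L z) (hL : L ≤ L') : ReachableTop n L' z := by
  obtain ⟨g, h1, h2, h3⟩ := hz
  exact ⟨g, h1.mono hL, h2, h3⟩

lemma reachableTop_zero (hn : n ≠ 0) : ReachableTop n 0 (0 : (Fin n → Fin d) → ℝ) := by
  refine ⟨_, reachable_one, fun w hw _ => by simp [hw], fun v => ?_⟩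
  rw [if_neg (by simpa using hn)]
  rfl

lemma ReachableTop.add (hn : n ≠ 0) (hz : ReachableTop n L z) (hz' : ReachableTop n L' z') :
    ReachableTop n (2 * (L + L')) (z + z') := by
  obtain ⟨g, h1, h2, h3⟩ := hz
  obtain ⟨g', h1', h2', h3'⟩ := hz'
  refine ⟨_, h1.chenMul h1', fun w hw hwn => ?_, fun v => ?_⟩
  · rw [chenMul_of_vanishing h1.nil h2 w hw hwn.le, h2 w hw hwn, h2' w hw hwn]
    simp
  · rw [chenMul_of_vanishing h1.nil h2 _ (by simpa using hn) (by simp), h3, h3', h1'.nil]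
    simp

lemma ReachableTop.neg (hn : n ≠ 0) (hz : ReachableTop n L z) : ReachableTop n L (-z) := by
  obtain ⟨g, h1, h2, h3⟩ := hz
  obtain ⟨g', h1', h'⟩ := h1.exists_inv
  have key : ∀ m ≤ n, ∀ w : List (Fin d), w ≠ [] → w.length = m → g' w = -g w := by
    intro m
    induction m using Nat.strong_induction_on with
    | _ m ih =>
      intro hm w hw hwm
      have h4 := chenMul_of_vanishing (g := g') (h := g) (n := m) h1'.nil (fun v hv hvm => by
        rw [ih _ hvm (hvm.le.trans hm) v hv rfl, h2 v hv (hvm.trans_le hm), neg_zero]) w hw hwm.le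
      rw [h' w hw, h1.nil] at h4
      linarith
  refine ⟨g', h1', fun w hw hwn => ?_, fun v => ?_⟩
  · rw [key _ hwn.le w hw rfl, h2 w hw hwn, neg_zero]
  · rw [key n le_rfl _ (by simpa using hn) (by simp), h3]
    rfl

lemma ReachableTop.smul (hn : n ≠ 0) (hz : ReachableTop n L z) {c r : ℝ} (hr : 0 ≤ r)
    (hc : |c| ≤ r ^ n) : ReachableTop n (L * r) (c • z) := by
  have hL : 0 ≤ L := by
    obtain ⟨g, h1, -⟩ := hz
    exact h1.nonneg
  wlog hc0 : 0 ≤ c generalizing c z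
  · have := this (hz.neg hn) (c := -c) (by rwa [abs_neg]) (by linarith)
    simpa using this
  obtain ⟨g, h1, h2, h3⟩ := hz
  rw [abs_of_nonneg hc0] at hc
  have hb : (c ^ (n⁻¹ : ℝ)) ^ n = c := Real.rpow_inv_natCast_pow hc0 hn
  have hb0 : 0 ≤ c ^ (n⁻¹ : ℝ) := by positivity
  refine ⟨_, (h1.dilate (c ^ (n⁻¹ : ℝ))).mono ?_, fun w hw hwn => by simp [h2 w hw hwn],
    fun v => ?_⟩
  · rw [abs_of_nonneg hb0, mul_comm]
    refine mul_le_mul_of_nonneg_left ?_ hL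
    exact le_of_pow_le_pow_left₀ hn hr (hb.trans_le hc)
  · simp [h3, hb]

/-- The linear space of degree `n` parts of reachable elements without lower degree parts. -/
def reachableTopSpace (d n : ℕ) (hn : n ≠ 0) : Submodule ℝ ((Fin n → Fin d) → ℝ) where
  carrier := {z | ∃ L, ReachableTop n L z}
  add_mem' := fun ⟨_, h⟩ ⟨_, h'⟩ => ⟨_, h.add hn h'⟩
  zero_mem' := ⟨0, reachableTop_zero hn⟩
  smul_mem' := fun c z ⟨L, h⟩ => by
    refine ⟨L * (|c| ⊔ 1), h.smul hn (by positivity) ?_⟩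
    exact (le_max_left _ _).trans (le_self_pow₀ (le_max_right _ _) hn)

/-- A quantitative Chow theorem in top degree. -/
lemma exists_reachableTop_of_mem (d n : ℕ) (hn : n ≠ 0) :
    ∃ C : ℝ, 0 ≤ C ∧ ∀ z ∈ reachableTopSpace d n hn, ∀ r : ℝ, 0 ≤ r → ‖z‖ ≤ r ^ n →
      ReachableTop n (C * r) z := by
  set V := reachableTopSpace d n hn
  set b := Module.finBasis ℝ V
  have step : ∀ s : Finset (Fin (Module.finrank ℝ V)), ∃ C : ℝ, 0 ≤ C ∧
      ∀ (c : Fin (Module.finrank ℝ V) → ℝ) (r : ℝ), 0 ≤ r → (∀ i, |c i| ≤ r ^ n) →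
        ReachableTop n (C * r) (∑ i ∈ s, c i • (b i : (Fin n → Fin d) → ℝ)) := by
    intro s
    induction s using Finset.induction_on with
    | empty =>
      exact ⟨0, le_rfl, fun c r _ _ => by simpa using reachableTop_zero hn⟩
    | insert i s hi ih =>
      obtain ⟨C, hC, h⟩ := ih
      obtain ⟨L, hL⟩ := (b i).2
      have hL0 : 0 ≤ L := by
        obtain ⟨g, h1, -⟩ := hL
        exact h1.nonneg
      refine ⟨2 * (L + C), by positivity, fun c r hr hc => ?_⟩
      rw [Finset.sum_insert hi]
      have := (hL.smul hn hr (hc i)).add hn (h c r hr hc)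
      convert this using 1
      ring
  obtain ⟨C, hC, hstep⟩ := step Finset.univ
  set T := LinearMap.toContinuousLinearMap b.equivFun.toLinearMap
  refine ⟨C * (‖T‖ ⊔ 1), by positivity, fun z hz r hr hzr => ?_⟩
  have h1 := hstep (T ⟨z, hz⟩) ((‖T‖ ⊔ 1) * r) (by positivity) fun i => by
    calc |T ⟨z, hz⟩ i| ≤ ‖T ⟨z, hz⟩‖ := norm_le_pi_norm (T ⟨z, hz⟩) i
      _ ≤ ‖T‖ * ‖z‖ := T.le_opNorm _
      _ ≤ (‖T‖ ⊔ 1) ^ n * r ^ n := by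
        refine mul_le_mul ?_ hzr (norm_nonneg _) (by positivity)
        exact (le_max_left _ _).trans (le_self_pow₀ (le_max_right _ _) hn)
      _ = _ := (mul_pow _ _ _).symm
  have h2 := congrArg Subtype.val (b.sum_equivFun ⟨z, hz⟩)
  rw [← mul_assoc] at h1
  convert h1
  refine h2.symm.trans ?_
  rw [Submodule.coe_sum]
  rfl

end Reachable

section DyadicSystem

variable {d : ℕ}

/-- Each dyadic interval carries the ordered product of its two halves, up to degree `n`. -/
def DyadicMatched (n : ℕ) (g : ℕ → ℕ → List (Fin d) → ℝ) : Prop :=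
  ∀ m k w, w.length ≤ n → g m k w = chenMul (g (m + 1) (2 * k + 1)) (g (m + 1) (2 * k)) w

lemma chenMul_singleton (g h : List (Fin d) → ℝ) (i : Fin d) :
    chenMul g h [i] = g [] * h [i] + g [i] * h [] := by
  simp [chenMul, Finset.sum_range_succ]

/-- A reachable element of degree one with prescribed coefficients. -/
lemma exists_reachable_singleton (a : Fin d → ℝ) :
    ∃ g, Reachable (6 * ‖a‖) g ∧ ∀ i, g [i] = a i := by
  set ψ : ℝ → ℝ := fun x => 6 * max 0 (x * (1 - x)) with hψ
  have hψc : Continuous ψ := by fun_prop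
  have hψ0 : ∀ x, x ∉ Set.Ioo (0 : ℝ) 1 → ψ x = 0 := fun x hx => by
    have : x * (1 - x) ≤ 0 := by
      by_contra! h
      refine hx ⟨?_, ?_⟩ <;> nlinarith
    simp [hψ, max_eq_left this]
  have hψb : ∀ x, |ψ x| ≤ 6 := fun x => by
    have h1 : max 0 (x * (1 - x)) ≤ 1 := max_le zero_le_one (by nlinarith [sq_nonneg (x - 1 / 2)])
    rw [abs_of_nonneg (by positivity)]
    simp only [hψ]
    linarith
  have hψi : ∫ x in (0 : ℝ)..1, ψ x = 1 := by
    rw [intervalIntegral.integral_congr (g := fun x : ℝ => 6 * x ^ 1 - 6 * x ^ 2)]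
    · rw [intervalIntegral.integral_sub (Continuous.intervalIntegrable (by fun_prop) _ _)
        (Continuous.intervalIntegrable (by fun_prop) _ _)]
      simp only [intervalIntegral.integral_const_mul, integral_pow]
      norm_num
    · intro x hx
      rw [Set.uIcc_of_le zero_le_one] at hx
      have : 0 ≤ x * (1 - x) := mul_nonneg hx.1 (by linarith [hx.2])
      simp only [hψ, max_eq_right this]
      ring
  refine ⟨_, ⟨fun x => ψ x • a, by fun_prop, fun x hx => by simp [hψ0 x hx], fun x => ?_,
    fun w => rfl⟩, fun i => ?_⟩
  · rw [norm_smul, Real.norm_eq_abs]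
    exact mul_le_mul_of_nonneg_right (hψb x) (norm_nonneg _)
  · simp [iterInt_cons, hψi]

/-- A solution of the recursion which distributes the defects `D` evenly among the halves of
each dyadic interval. -/
lemma exists_half_split {E : Type*} [NormedAddCommGroup E] [NormedSpace ℝ E]
    (V : Submodule ℝ E) (D : ℕ → ℕ → E) (hDV : ∀ m k, D m k ∈ V) {B Q : ℝ} (hB : 0 ≤ B)
    (hQ : 1 < 2 * Q) (hD : ∀ m k, ‖D m k‖ ≤ B * Q ^ m) :
    ∃ (c : ℕ → ℕ → E) (B' : ℝ), 0 ≤ B' ∧ (∀ m k, c m k ∈ V) ∧ (∀ m k, ‖c m k‖ ≤ B' * Q ^ m) ∧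
      ∀ m k, c (m + 1) (2 * k + 1) + c (m + 1) (2 * k) = c m k + D m k := by
  set c : ℕ → ℕ → E := fun m => Nat.rec (fun _ => 0)
    (fun m c k => (2⁻¹ : ℝ) • (c (k / 2) + D m (k / 2))) m with hc
  have hc1 : ∀ m k, c (m + 1) k = (2⁻¹ : ℝ) • (c m (k / 2) + D m (k / 2)) := fun m k => rfl
  have hQ0 : 0 < 2 * Q - 1 := by linarith
  refine ⟨c, B / (2 * Q - 1), by positivity, fun m => ?_, fun m => ?_, fun m k => ?_⟩
  · induction m with
    | zero => exact fun k => V.zero_mem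
    | succ m ih =>
      exact fun k => by
        rw [hc1]
        exact V.smul_mem _ (V.add_mem (ih _) (hDV _ _))
  · induction m with
    | zero =>
      intro k
      rw [show c 0 k = 0 from rfl, norm_zero]
      positivity
    | succ m ih =>
      intro k
      rw [hc1, norm_smul, Real.norm_eq_abs, abs_of_pos (by norm_num : (0 : ℝ) < 2⁻¹)]
      have h1 := (norm_add_le (c m (k / 2)) (D m (k / 2))).trans (add_le_add (ih _) (hD m _))
      have h2 : 2⁻¹ * (B / (2 * Q - 1) * Q ^ m + B * Q ^ m) = B / (2 * Q - 1) * Q ^ (m + 1) := by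
        field_simp
        ring
      linarith
  · rw [hc1, hc1, show (2 * k + 1) / 2 = k by omega, show 2 * k / 2 = k by omega, ← add_smul]
    norm_num

lemma reachable_chenMul_halves {q C : ℝ} (hq0 : 0 < q) (hq1 : q < 1) (hC : 0 ≤ C)
    (g : ℕ → ℕ → List (Fin d) → ℝ) (hg : ∀ m k, Reachable (C * q ^ m) (g m k)) (m k : ℕ) :
    Reachable (4 * C * q ^ m) (chenMul (g (m + 1) (2 * k + 1)) (g (m + 1) (2 * k))) := by
  refine ((hg _ _).chenMul (hg _ _)).mono ?_
  have : C * q ^ (m + 1) ≤ C * q ^ m :=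
    mul_le_mul_of_nonneg_left (pow_le_pow_of_le_one hq0.le hq1.le (m.le_add_right 1)) hC
  linarith

lemma abs_sub_chenMul_halves_le {q C : ℝ} (hq0 : 0 < q) (hq1 : q < 1) (hC : 0 ≤ C)
    (g : ℕ → ℕ → List (Fin d) → ℝ) (hg : ∀ m k, Reachable (C * q ^ m) (g m k)) (m k : ℕ)
    (w : List (Fin d)) :
    |g m k w - chenMul (g (m + 1) (2 * k + 1)) (g (m + 1) (2 * k)) w| ≤
      2 * (4 * C) ^ w.length * (q ^ w.length) ^ m := by
  have h1 := ((hg m k).mono (L' := 4 * C * q ^ m)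
    (by nlinarith [mul_nonneg hC (pow_nonneg hq0.le m)])).abs_le w
  have h2 := (reachable_chenMul_halves hq0 hq1 hC g hg m k).abs_le w
  rw [mul_pow, ← pow_mul, mul_comm m, pow_mul] at h1 h2
  refine (abs_sub _ _).trans ?_
  linarith

/-- Matching on dyadic intervals can be improved by one degree as long as `q ^ (n + 1) > 1 / 2`. -/
lemma exists_dyadicMatched_succ {n : ℕ} {q C : ℝ} (hq0 : 0 < q) (hq1 : q < 1)
    (hq : 1 < 2 * q ^ (n + 1)) (hC : 0 ≤ C) (g : ℕ → ℕ → List (Fin d) → ℝ)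
    (hg : ∀ m k, Reachable (C * q ^ m) (g m k)) (hgm : DyadicMatched n g) :
    ∃ (C' : ℝ) (g' : ℕ → ℕ → List (Fin d) → ℝ), 0 ≤ C' ∧
      (∀ m k, Reachable (C' * q ^ m) (g' m k)) ∧ DyadicMatched (n + 1) g' ∧
      ∀ m k w, w.length ≤ n → g' m k w = g m k w := by
  have hn1 : n + 1 ≠ 0 := by omega
  set D : ℕ → ℕ → (Fin (n + 1) → Fin d) → ℝ := fun m k v => g m k (List.ofFn v) -
    chenMul (g (m + 1) (2 * k + 1)) (g (m + 1) (2 * k)) (List.ofFn v) with hD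
  have hprod := reachable_chenMul_halves hq0 hq1 hC g hg
  have hDV : ∀ m k, D m k ∈ reachableTopSpace d (n + 1) hn1 := fun m k => by
    obtain ⟨g', h1, h2⟩ := (hprod m k).exists_inv
    have key : ∀ w : List (Fin d), w ≠ [] → w.length ≤ n + 1 → chenMul g' (g m k) w =
        g m k w - chenMul (g (m + 1) (2 * k + 1)) (g (m + 1) (2 * k)) w := fun w hw hwn => by
      have := chenMul_sub_chenMul (g := g') (g' := g') (h' := g m k)
        (h := chenMul (g (m + 1) (2 * k + 1)) (g (m + 1) (2 * k))) hw (fun _ _ => rfl)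
        fun v hv => hgm m k v (by omega)
      rw [h2 w hw, h1.nil] at this
      linarith
    refine ⟨_, _, h1.chenMul (hg m k), fun w hw hwn => ?_, fun v => ?_⟩
    · rw [key w hw hwn.le, hgm m k w (by omega), sub_self]
    · rw [key _ (by simp) (by simp)]
  have hDB : ∀ m k, ‖D m k‖ ≤ 2 * (4 * C) ^ (n + 1) * (q ^ (n + 1)) ^ m := fun m k => by
    refine (pi_norm_le_iff_of_nonneg (by positivity)).2 fun v => ?_
    have h := abs_sub_chenMul_halves_le hq0 hq1 hC g hg m k (List.ofFn v)
    rw [List.length_ofFn] at h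
    exact h
  obtain ⟨c, B, hB, hcV, hcB, hcD⟩ := exists_half_split _ D hDV (by positivity) hq hDB
  obtain ⟨K, hK, hKc⟩ := exists_reachableTop_of_mem d (n + 1) hn1
  have hc : ∀ m k, ReachableTop (n + 1) (K * ((B ⊔ 1) * q ^ m)) (c m k) := fun m k => by
    refine hKc _ (hcV m k) _ (by positivity) ((hcB m k).trans ?_)
    rw [mul_pow, ← pow_mul, ← pow_mul, mul_comm m]
    gcongr
    exact (le_max_left _ _).trans (le_self_pow₀ (le_max_right _ _) hn1)
  choose l hl1 hl2 hl3 using hc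
  have hlow : ∀ m k w, w.length ≤ n → chenMul (l m k) (g m k) w = g m k w := fun m k w hw => by
    rcases eq_or_ne w [] with rfl | hw0
    · rw [chenMul_nil, (hl1 m k).nil, one_mul]
    · rw [chenMul_of_vanishing (hl1 m k).nil (hl2 m k) w hw0 (by omega), hl2 m k w hw0 (by omega),
        zero_mul, zero_add]
  have htop : ∀ m k v, chenMul (l m k) (g m k) (List.ofFn v) = c m k v + g m k (List.ofFn v) :=
    fun m k v => by
      rw [chenMul_of_vanishing (hl1 m k).nil (hl2 m k) _ (by simp) (by simp), hl3, (hg m k).nil,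
        mul_one]
  refine ⟨2 * (K * (B ⊔ 1) + C), fun m k => chenMul (l m k) (g m k), by positivity,
    fun m k => ?_, fun m k w hw => ?_, hlow⟩
  · convert (hl1 m k).chenMul (hg m k) using 1
    ring
  · rcases hw.lt_or_eq with hw | hw
    · have hw : w.length ≤ n := by omega
      simp only
      rw [hlow m k w hw, hgm m k w hw]
      exact chenMul_congr (fun v hv => (hlow _ _ v (by omega)).symm)
        fun v hv => (hlow _ _ v (by omega)).symm
    · obtain ⟨v, rfl⟩ : ∃ v : Fin (n + 1) → Fin d, w = List.ofFn v := by
        rw [← hw]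
        exact ⟨w.get, (List.ofFn_get w).symm⟩
      have h1 := chenMul_sub_chenMul (g := g (m + 1) (2 * k + 1)) (h := g (m + 1) (2 * k))
        (g' := chenMul (l (m + 1) (2 * k + 1)) (g (m + 1) (2 * k + 1)))
        (h' := chenMul (l (m + 1) (2 * k)) (g (m + 1) (2 * k))) (w := List.ofFn v) (by simp)
        (fun v hv => hlow _ _ v (by simp at hv; omega))
        fun v hv => hlow _ _ v (by simp at hv; omega)
      have h2 := congrFun (hcD m k) v
      simp only [Pi.add_apply, hD] at h2
      rw [(hg _ _).nil, (hg _ _).nil, htop, htop] at h1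
      simp only
      rw [htop]
      linarith

/-- Every additive family of increments on dyadic intervals lifts to a family of reachable
elements which are matched up to degree `n`, as long as `q ^ n > 1 / 2`. -/
theorem exists_dyadicMatched {n : ℕ} (hn : n ≠ 0) {q A : ℝ} (hq0 : 0 < q) (hq1 : q < 1)
    (hq : 1 < 2 * q ^ n) (hA : 0 ≤ A) (a : ℕ → ℕ → Fin d → ℝ)
    (ha : ∀ m k, ‖a m k‖ ≤ A * q ^ m)
    (hadd : ∀ m k, a m k = a (m + 1) (2 * k) + a (m + 1) (2 * k + 1)) :
    ∃ (C : ℝ) (g : ℕ → ℕ → List (Fin d) → ℝ), 0 ≤ C ∧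
      (∀ m k, Reachable (C * q ^ m) (g m k)) ∧ DyadicMatched n g ∧
      ∀ m k i, g m k [i] = a m k i := by
  induction n, Nat.one_le_iff_ne_zero.2 hn using Nat.le_induction with
  | base =>
    choose g hg1 hg2 using fun m k => exists_reachable_singleton (a m k)
    refine ⟨6 * A, g, by positivity, fun m k => (hg1 m k).mono ?_, fun m k w hw => ?_, hg2⟩
    · linarith [ha m k]
    · rcases w with _ | ⟨i, _ | ⟨j, w⟩⟩
      · simp [chenMul_nil, (hg1 _ _).nil]
      · simp [chenMul_singleton, (hg1 _ _).nil, hg2, hadd m k]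
      · simp at hw
  | succ n hn' ih =>
    have hq' : 1 < 2 * q ^ n := by
      have := pow_le_pow_of_le_one hq0.le hq1.le (n.le_add_right 1)
      linarith
    obtain ⟨C, g, hC, hg, hgm, hga⟩ := ih (by omega) hq'
    obtain ⟨C', g', hC', hg', hgm', hgg⟩ :=
      exists_dyadicMatched_succ hq0 hq1 hq hC g hg hgm
    exact ⟨C', g', hC', hg', hgm', fun m k i => by rw [hgg _ _ _ (by simpa using hn'), hga]⟩

end DyadicSystem

section HolderBounds

variable {d : ℕ}

/-- Reachable elements on the intervals `[k / N, (k + 1) / N]` are realised by a single path. -/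
lemma exists_glue {N : ℕ} (hN : 0 < N) {L : ℝ} (g : ℕ → List (Fin d) → ℝ)
    (hg : ∀ k, Reachable L (g k)) :
    ∃ φ : ℝ → Fin d → ℝ, Continuous φ ∧ (∀ x, x ∉ Set.Ioo (0 : ℝ) 1 → φ x = 0) ∧
      (∀ x, ‖φ x‖ ≤ N * L) ∧
      ∀ k : ℕ, k < N → ∀ w, iterInt φ w (((k : ℝ) + 1) / N) (k / N) = g k w := by
  choose f f1 f2 f3 f4 using hg
  have hN' : (0 : ℝ) < N := by exact_mod_cast hN
  have hL : 0 ≤ L := (norm_nonneg _).trans (f3 0 0)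
  set φ : ℝ → Fin d → ℝ := fun x =>
    ∑ k ∈ Finset.range N, (N : ℝ) • f k (N * x + -(k : ℝ)) with hφ
  have hloc : ∀ k : ℕ, k < N → ∀ x : ℝ, 0 ≤ N * x - k → N * x - k ≤ 1 →
      φ x = (N : ℝ) • f k (N * x + -(k : ℝ)) := fun k hk x h0 h1 => by
    refine Finset.sum_eq_single_of_mem k (Finset.mem_range.2 hk) fun j _ hjk => ?_
    rw [f2 j _ fun h => ?_, smul_zero]
    have h2 : (j : ℝ) < k + 1 := by linarith [h.1]
    have h3 : (k : ℝ) < j + 1 := by linarith [h.2]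
    norm_cast at h2 h3
    omega
  have hout : ∀ x : ℝ, (∀ k : ℕ, k < N → ¬ (0 ≤ N * x - k ∧ N * x - (k : ℝ) ≤ 1)) → φ x = 0 := fun x hx =>
    Finset.sum_eq_zero fun k hk => by
      rw [f2 k _ fun h => hx k (Finset.mem_range.1 hk)
        ⟨by linarith [h.1], by linarith [h.2]⟩, smul_zero]
  refine ⟨φ, by fun_prop, fun x hx => ?_, fun x => ?_, fun k hk w => ?_⟩
  · refine Finset.sum_eq_zero fun k hk => ?_
    rw [f2 k _ fun h => hx ?_, smul_zero]
    have hk' : (k : ℝ) + 1 ≤ N := by exact_mod_cast Finset.mem_range.1 hk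
    have hk0 : (0 : ℝ) ≤ k := k.cast_nonneg
    constructor <;> by_contra! hc
    · nlinarith [h.1]
    · nlinarith [h.2]
  · by_cases hx : ∃ k : ℕ, k < N ∧ 0 ≤ N * x - k ∧ N * x - (k : ℝ) ≤ 1
    · obtain ⟨k, hk, h0, h1⟩ := hx
      rw [hloc k hk x h0 h1, norm_smul, Real.norm_natCast]
      exact mul_le_mul_of_nonneg_left (f3 _ _) hN'.le
    · push Not at hx
      rw [hout x fun k hk h => (hx k hk h.1).not_ge h.2, norm_zero]
      positivity
  · rw [iterInt_congr (h := fun x => (N : ℝ) • f k (N * x + -(k : ℝ))), iterInt_comp_affine, ← f4]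
    · congr 1 <;> field_simp <;> ring
    · intro x hx
      rw [Set.uIcc_of_le (by gcongr; linarith)] at hx
      refine hloc k hk x ?_ ?_
      · have := (div_le_iff₀ hN').1 hx.1
        linarith
      · have := (le_div_iff₀ hN').1 hx.2
        linarith

/-- A subadditive quantity which is `β`-Hölder on dyadic intervals up to some scale and on all
smaller intervals is `β`-Hölder, uniformly in the scale. -/
lemma holder_of_dyadic {β q A : ℝ} (hβ : 0 < β) (hq0 : 0 < q) (hq1 : q < 1)
    (hq : ∀ l : ℕ, q ^ l = (1 / (2 : ℝ) ^ l) ^ β) (hA : 0 ≤ A) (m : ℕ) (P : ℝ → ℝ → ℝ → Prop)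
    (hmono : ∀ s t r r', P s t r → r ≤ r' → P s t r')
    (hadd : ∀ s u t r r', P s u r → P u t r' → P s t (r + r'))
    (dyadic : ∀ l ≤ m, ∀ k : ℕ, k < 2 ^ l →
      P ((k : ℝ) / 2 ^ l) (((k : ℝ) + 1) / 2 ^ l) (A * q ^ l))
    (small : ∀ s t, s ≤ t → t - s ≤ 1 / 2 ^ m → P s t (A * (t - s) ^ β))
    (s t : ℝ) (hs : 0 ≤ s) (hst : s ≤ t) (ht : t ≤ 1) :
    P s t (3 * (A / (1 - q)) * (t - s) ^ β) := by
  have hq1' : 0 < 1 - q := by linarith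
  set A' := A / (1 - q) with hA'
  have hA'0 : 0 ≤ A' := by positivity
  have hA'q : A = A' - A' * q := by
    rw [hA']
    field_simp
  have hAA' : A ≤ A' := by nlinarith
  have anchored : ∀ j l : ℕ, l + j = m → ∀ k : ℕ, k < 2 ^ l → ∀ x : ℝ,
      (k : ℝ) / 2 ^ l ≤ x → x ≤ ((k : ℝ) + 1) / 2 ^ l →
      P (k / 2 ^ l) x (A' * q ^ l) ∧ P x ((k + 1) / 2 ^ l) (A' * q ^ l) := by
    intro j
    induction j with
    | zero =>
      intro l hl k hk x h0 h1
      obtain rfl : l = m := by omega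
      have hd : ((k : ℝ) + 1) / 2 ^ l = k / 2 ^ l + 1 / 2 ^ l := add_div _ _ _
      have aux : ∀ y : ℝ, 0 ≤ y → y ≤ 1 / 2 ^ l → A * y ^ β ≤ A' * q ^ l := fun y hy0 hy1 => by
        rw [hq]
        gcongr
      exact ⟨hmono _ _ _ _ (small _ _ h0 (by linarith)) (aux _ (by linarith) (by linarith)),
        hmono _ _ _ _ (small _ _ h1 (by linarith)) (aux _ (by linarith) (by linarith))⟩
    | succ j ih =>
      intro l hl k hk x h0 h1
      have e0 : ((2 * k : ℕ) : ℝ) / 2 ^ (l + 1) = k / 2 ^ l := by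
        push_cast
        field_simp
        ring
      have e1 : ((2 * k : ℕ) + 1 : ℝ) / 2 ^ (l + 1) = ((2 * k + 1 : ℕ) : ℝ) / 2 ^ (l + 1) := by
        push_cast
        rfl
      have e2 : ((2 * k + 1 : ℕ) + 1 : ℝ) / 2 ^ (l + 1) = (k + 1) / 2 ^ l := by
        push_cast
        field_simp
        ring
      have hk0 : 2 * k < 2 ^ (l + 1) := by rw [pow_succ]; omega
      have hk1 : 2 * k + 1 < 2 ^ (l + 1) := by rw [pow_succ]; omega
      have b0 := dyadic (l + 1) (by omega) _ hk0
      have b1 := dyadic (l + 1) (by omega) _ hk1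
      have hsum : A * q ^ (l + 1) + A' * q ^ (l + 1) ≤ A' * q ^ l := by
        have : A' * q ^ l - (A * q ^ (l + 1) + A' * q ^ (l + 1)) = A' * (1 - q) * q ^ l * (1 - q) := by
          rw [hA'q]
          ring
        have : 0 ≤ A' * (1 - q) * q ^ l * (1 - q) := by positivity
        linarith
      have hone : A' * q ^ (l + 1) ≤ A' * q ^ l :=
        mul_le_mul_of_nonneg_left (pow_le_pow_of_le_one hq0.le hq1.le (l.le_add_right 1)) hA'0
      rcases le_total x (((2 * k + 1 : ℕ) : ℝ) / 2 ^ (l + 1)) with hx | hx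
      · obtain ⟨i1, i2⟩ := ih (l + 1) (by omega) _ hk0 x (by rwa [e0]) (by rwa [e1])
        rw [e0] at i1
        rw [e1] at i2
        rw [e2] at b1
        exact ⟨hmono _ _ _ _ i1 hone, hmono _ _ _ _ (hadd _ _ _ _ _ i2 b1) (by linarith)⟩
      · obtain ⟨i1, i2⟩ := ih (l + 1) (by omega) _ hk1 x hx (by rwa [e2])
        rw [e2] at i2
        rw [e0, e1] at b0
        exact ⟨hmono _ _ _ _ (hadd _ _ _ _ _ b0 i1) hsum, hmono _ _ _ _ i2 hone⟩
  have hts : 0 ≤ (t - s) ^ β := Real.rpow_nonneg (by linarith) _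
  rcases le_or_gt (t - s) (1 / 2 ^ m) with hsm | hlarge
  · refine hmono _ _ _ _ (small s t hst hsm) ?_
    gcongr
    linarith
  have hex : ∃ l : ℕ, 1 / (2 : ℝ) ^ l ≤ t - s := ⟨m, hlarge.le⟩
  classical
  set l := Nat.find hex with hl
  have hl1 : 1 / (2 : ℝ) ^ l ≤ t - s := Nat.find_spec hex
  have hlm : l ≤ m := Nat.find_min' hex hlarge.le
  have hl2 : t - s ≤ 2 / (2 : ℝ) ^ l := by
    rcases Nat.eq_zero_or_pos l with h0 | h0
    · rw [h0]
      norm_num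
      linarith
    · obtain ⟨j, hj⟩ := Nat.exists_eq_succ_of_ne_zero h0.ne'
      have := Nat.find_min hex (m := j) (by omega)
      rw [hj, pow_succ, mul_comm, ← div_div, div_self two_ne_zero]
      linarith
  have h2 : (0 : ℝ) < 2 ^ l := by positivity
  have hql : q ^ l ≤ (t - s) ^ β := by
    rw [hq]
    gcongr
  set k := ⌊s * 2 ^ l⌋₊ with hk
  have hk1 : (k : ℝ) / 2 ^ l ≤ s := by
    rw [div_le_iff₀ h2]
    exact Nat.floor_le (by positivity)
  have hk2 : s ≤ ((k : ℝ) + 1) / 2 ^ l := by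
    rw [le_div_iff₀ h2]
    exact (Nat.lt_floor_add_one _).le
  have hlt : ∀ j : ℕ, (j : ℝ) / 2 ^ l < 1 → j < 2 ^ l := fun j hj => by
    rw [div_lt_one h2] at hj
    exact_mod_cast hj
  have hpos : 0 < 1 / (2 : ℝ) ^ l := by positivity
  have ekl : ((k : ℝ) + 1) / 2 ^ l = k / 2 ^ l + 1 / 2 ^ l := add_div _ _ _
  have first := (anchored (m - l) l (by omega) k (hlt k (by linarith)) s hk1 hk2).2
  have hres : ∀ r, r ≤ 3 * (A' * q ^ l) → r ≤ 3 * A' * (t - s) ^ β := fun r hr => by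
    nlinarith [mul_le_mul_of_nonneg_left hql hA'0]
  have hnn : 0 ≤ A' * q ^ l := by positivity
  have hAl : A * q ^ l ≤ A' * q ^ l := by gcongr
  rcases eq_or_lt_of_le (show ((k : ℝ) + 1) / 2 ^ l ≤ t by linarith) with h | h
  · rw [h] at first
    exact hmono _ _ _ _ first (hres _ (by linarith))
  have hk' : k + 1 < 2 ^ l := hlt _ (by push_cast; linarith)
  have ekl2 : ((k : ℝ) + 1 + 1) / 2 ^ l = (k + 1) / 2 ^ l + 1 / 2 ^ l := add_div _ _ _
  rcases le_or_gt t (((k : ℝ) + 1 + 1) / 2 ^ l) with h' | h'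
  · have second := (anchored (m - l) l (by omega) (k + 1) hk' t (by push_cast; linarith)
      (by push_cast; linarith)).1
    push_cast at second
    exact hmono _ _ _ _ (hadd _ _ _ _ _ first second) (hres _ (by linarith))
  · have hk'' : k + 1 + 1 < 2 ^ l := hlt _ (by push_cast; linarith)
    have ekl3 : ((k : ℝ) + 1 + 1 + 1) / 2 ^ l = (k + 1 + 1) / 2 ^ l + 1 / 2 ^ l := add_div _ _ _
    have etwo : 2 / (2 : ℝ) ^ l = 1 / 2 ^ l + 1 / 2 ^ l := by ring
    have second := dyadic l hlm (k + 1) hk'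
    have third := (anchored (m - l) l (by omega) (k + 1 + 1) hk'' t (by push_cast; linarith)
      (by push_cast; linarith)).1
    push_cast at second third
    exact hmono _ _ _ _ (hadd _ _ _ _ _ (hadd _ _ _ _ _ first second) third)
      (hres _ (by linarith))

lemma abs_chenMul_le {g h : List (Fin d) → ℝ} {r r' : ℝ} {n : ℕ} (hr : 0 ≤ r) (hr' : 0 ≤ r')
    (hg : ∀ w : List (Fin d), w.length ≤ n → |g w| ≤ r ^ w.length)
    (hh : ∀ w : List (Fin d), w.length ≤ n → |h w| ≤ r' ^ w.length)
    (w : List (Fin d)) (hw : w.length ≤ n) : |chenMul g h w| ≤ (r + r') ^ w.length := by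
  rw [add_pow]
  refine (Finset.abs_sum_le_sum_abs _ _).trans (Finset.sum_le_sum fun k hk => ?_)
  have hk : k ≤ w.length := by
    rw [Finset.mem_range] at hk
    omega
  have h1 := hg (w.take k) (by simp; omega)
  have h2 := hh (w.drop k) (by simp; omega)
  rw [List.length_take, min_eq_left hk] at h1
  rw [List.length_drop] at h2
  rw [abs_mul]
  refine (mul_le_mul h1 h2 (abs_nonneg _) (by positivity)).trans ?_
  refine le_mul_of_one_le_right (by positivity) ?_
  exact_mod_cast Nat.choose_pos hk

lemma chenMul_one_left (h : List (Fin d) → ℝ) (w : List (Fin d)) :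
    chenMul (fun w : List (Fin d) => if w = [] then 1 else 0) h w = h w := by
  unfold chenMul
  rw [Finset.sum_eq_single 0]
  · simp
  · intro k hk hk0
    rw [Finset.mem_range] at hk
    have : w.take k ≠ [] := by
      rw [Ne, List.take_eq_nil_iff]
      rintro (h | rfl)
      · exact hk0 h
      · simp at hk; omega
    simp only [this, if_false, zero_mul]
  · simp

lemma chenMul_one_right (g : List (Fin d) → ℝ) (w : List (Fin d)) :
    chenMul g (fun w : List (Fin d) => if w = [] then 1 else 0) w = g w := by
  unfold chenMul
  rw [Finset.sum_eq_single w.length]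
  · simp
  · intro k hk hk0
    rw [Finset.mem_range] at hk
    have : w.drop k ≠ [] := by
      rw [Ne, List.drop_eq_nil_iff]
      omega
    simp only [this, if_false, mul_zero]
  · simp

/-- Reversing the time interval at most doubles the size of the iterated integrals. -/
lemma abs_iterInt_swap_le {f : ℝ → Fin d → ℝ} (hf : Continuous f) {n : ℕ} {r t s : ℝ}
    (h : ∀ w : List (Fin d), w.length ≤ n → |iterInt f w t s| ≤ r ^ w.length) (hr : 0 ≤ r) :
    ∀ w : List (Fin d), w.length ≤ n → |iterInt f w s t| ≤ (2 * r) ^ w.length := by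
  intro w
  induction hk : w.length using Nat.strong_induction_on generalizing w with
  | _ k ih =>
    subst hk
    intro hw
    rcases eq_or_ne w [] with rfl | hw0
    · simp
    have h0 := iterInt_chen hf w s t s
    rw [iterInt_self w hw0, chenMul, Finset.sum_range_succ, List.take_length, List.drop_length,
      iterInt_nil, mul_one] at h0
    rw [eq_neg_of_add_eq_zero_right h0.symm, abs_neg]
    have hterm : ∀ k ∈ Finset.range w.length,
        |iterInt f (w.take k) s t * iterInt f (w.drop k) t s| ≤ 2 ^ k * r ^ w.length := by
      intro k hk
      rw [Finset.mem_range] at hk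
      have h1 := ih k hk (w.take k) (by rw [List.length_take]; omega) (by omega)
      have h2 := h (w.drop k) (by simp; omega)
      rw [List.length_drop] at h2
      rw [abs_mul]
      refine (mul_le_mul h1 h2 (abs_nonneg _) (by positivity)).trans_eq ?_
      rw [mul_pow, mul_assoc, ← pow_add, Nat.add_sub_cancel' hk.le]
    refine (Finset.abs_sum_le_sum_abs _ _).trans ((Finset.sum_le_sum hterm).trans ?_)
    rw [← Finset.sum_mul, mul_pow]
    refine mul_le_mul_of_nonneg_right ?_ (by positivity)
    rw [geom_sum_eq (by norm_num)]
    norm_num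

lemma iterInt_eq_one {f : ℝ → Fin d → ℝ} {t s : ℝ} (h : ∀ x ∈ Set.uIcc s t, f x = 0)
    (w : List (Fin d)) : iterInt f w t s = if w = [] then 1 else 0 := by
  rw [iterInt_congr (h := 0) w h]
  split_ifs with hw
  · rw [hw, iterInt_nil]
  · exact iterInt_zero w hw t s

/-- Outside of the support of the velocity, iterated integrals are constant. -/
lemma iterInt_clamp {f : ℝ → Fin d → ℝ} (hf : Continuous f)
    (hf0 : ∀ x, x ∉ Set.Ioo (0 : ℝ) 1 → f x = 0) (w : List (Fin d)) (t s : ℝ) :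
    iterInt f w t s = iterInt f w (max 0 (min 1 t)) (max 0 (min 1 s)) := by
  have key : ∀ x : ℝ, max 0 (min 1 x) = x ∨ ∀ y ∈ Set.uIcc x (max 0 (min 1 x)), f y = 0 :=
    fun x => by
      rcases le_total x 0 with hx | hx
      · rw [min_eq_right (by linarith), max_eq_left hx, Set.uIcc_of_le hx]
        exact Or.inr fun y hy => hf0 y fun h => absurd hy.2 h.1.not_ge
      rcases le_total 1 x with hx1 | hx1
      · rw [min_eq_left hx1, max_eq_right zero_le_one, Set.uIcc_of_ge hx1]
        exact Or.inr fun y hy => hf0 y fun h => absurd hy.1 h.2.not_ge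
      · exact Or.inl (by rw [min_eq_right hx1, max_eq_right hx])
  have left : ∀ (x : ℝ) (v : List (Fin d)),
      iterInt f v x (max 0 (min 1 x)) = if v = [] then 1 else 0 := fun x v => by
    rcases key x with h | h
    · rw [h]
      split_ifs with hv
      · rw [hv, iterInt_nil]
      · exact iterInt_self v hv x
    · exact iterInt_eq_one (by rwa [Set.uIcc_comm]) v
  have right : ∀ (x : ℝ) (v : List (Fin d)),
      iterInt f v (max 0 (min 1 x)) x = if v = [] then 1 else 0 := fun x v => by
    rcases key x with h | h
    · rw [h]
      split_ifs with hv
      · rw [hv, iterInt_nil]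
      · exact iterInt_self v hv x
    · exact iterInt_eq_one h v
  rw [iterInt_chen hf w t (max 0 (min 1 t)) s]
  simp only [left]
  rw [chenMul_one_left, iterInt_chen hf w _ (max 0 (min 1 s)) s]
  simp only [right]
  rw [chenMul_one_right]

end HolderBounds

section DyadicPaths

variable {d : ℕ}

/-- The velocity `φ` on `[0, 1]` realises the elements `g m k` on dyadic intervals of scale `m`. -/
structure RealizesDyadic (C q : ℝ) (g : ℕ → ℕ → List (Fin d) → ℝ) (m : ℕ)
    (φ : ℝ → Fin d → ℝ) : Prop where
  continuous : Continuous φ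
  eq_zero : ∀ x, x ∉ Set.Ioo (0 : ℝ) 1 → φ x = 0
  norm_le : ∀ x, ‖φ x‖ ≤ 2 ^ m * (C * q ^ m)
  iterInt_eq : ∀ k : ℕ, k < 2 ^ m → ∀ w,
    iterInt φ w (((k : ℝ) + 1) / 2 ^ m) (k / 2 ^ m) = g m k w

lemma exists_realizesDyadic {C q : ℝ} (g : ℕ → ℕ → List (Fin d) → ℝ)
    (hg : ∀ m k, Reachable (C * q ^ m) (g m k)) (m : ℕ) : ∃ φ, RealizesDyadic C q g m φ := by
  obtain ⟨φ, h1, h2, h3, h4⟩ := exists_glue (N := 2 ^ m) (by positivity) (g m) (hg m)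
  push_cast at h3 h4
  exact ⟨φ, h1, h2, h3, h4⟩

/-- A path realising `g` at scale `m` realises it at coarser scales, up to an error in the first
degree which is not matched. -/
lemma RealizesDyadic.coarse {C q : ℝ} {g : ℕ → ℕ → List (Fin d) → ℝ} {m : ℕ}
    {φ : ℝ → Fin d → ℝ} (hφ : RealizesDyadic C q g m φ) (hq0 : 0 < q) (hq1 : q < 1) (hC : 0 ≤ C)
    (hg : ∀ m k, Reachable (C * q ^ m) (g m k)) {K : ℕ} (hK : 2 * q ^ (K + 1) < 1)
    (hgm : DyadicMatched K g) : ∀ l : ℕ, l ≤ m → ∀ k : ℕ, k < 2 ^ l → ∀ w : List (Fin d),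
      (w.length ≤ K → iterInt φ w (((k : ℝ) + 1) / 2 ^ l) (k / 2 ^ l) = g l k w) ∧
      (w.length = K + 1 → |iterInt φ w (((k : ℝ) + 1) / 2 ^ l) (k / 2 ^ l) - g l k w| ≤
        2 * (4 * C) ^ (K + 1) / (1 - 2 * q ^ (K + 1)) * (q ^ (K + 1)) ^ l) := by
  set Q := q ^ (K + 1) with hQ
  have hQ0 : 0 < Q := by positivity
  have hQ1 : 0 < 1 - 2 * Q := by linarith
  intro l hl
  induction hl using Nat.decreasingInduction with
  | self =>
    intro k hk w
    rw [hφ.iterInt_eq k hk, sub_self, abs_zero]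
    exact ⟨fun _ => rfl, fun _ => by positivity⟩
  | of_succ l hl ih =>
    intro k hk w
    have e0 : ((2 * k : ℕ) : ℝ) / 2 ^ (l + 1) = k / 2 ^ l := by
      push_cast
      field_simp
      ring
    have e1 : (((2 * k : ℕ) : ℝ) + 1) / 2 ^ (l + 1) = ((2 * k + 1 : ℕ) : ℝ) / 2 ^ (l + 1) := by
      push_cast
      rfl
    have e2 : (((2 * k + 1 : ℕ) : ℝ) + 1) / 2 ^ (l + 1) = (k + 1) / 2 ^ l := by
      push_cast
      field_simp
      ring
    have hk0 : 2 * k < 2 ^ (l + 1) := by rw [pow_succ]; omega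
    have hk1 : 2 * k + 1 < 2 ^ (l + 1) := by rw [pow_succ]; omega
    have i0 := ih _ hk0
    have i1 := ih _ hk1
    rw [e0, e1] at i0
    rw [e2] at i1
    have hchen := iterInt_chen hφ.continuous w (((k : ℝ) + 1) / 2 ^ l)
      (((2 * k + 1 : ℕ) : ℝ) / 2 ^ (l + 1)) (k / 2 ^ l)
    refine ⟨fun hw => ?_, fun hw => ?_⟩
    · rw [hchen, hgm l k w hw]
      exact chenMul_congr (fun v hv => (i1 v).1 (hv.trans hw)) fun v hv => (i0 v).1 (hv.trans hw)
    · have hw0 : w ≠ [] := by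
        rintro rfl
        simp at hw
      have h1 := chenMul_sub_chenMul (w := w) hw0
        (fun v hv => (i1 v).1 (by omega)) fun v hv => (i0 v).1 (by omega)
      rw [← hchen, (hg _ _).nil, (hg _ _).nil, one_mul, mul_one] at h1
      have h2 := abs_sub_chenMul_halves_le hq0 hq1 hC g hg l k w
      rw [hw, ← hQ, abs_sub_comm] at h2
      have h3 := (i1 w).2 hw
      have h4 := (i0 w).2 hw
      set B := 2 * (4 * C) ^ (K + 1)
      have h5 : B / (1 - 2 * Q) * Q ^ (l + 1) + B / (1 - 2 * Q) * Q ^ (l + 1) + B * Q ^ l =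
          B / (1 - 2 * Q) * Q ^ l := by
        field_simp
        ring
      rw [show iterInt φ w (((k : ℝ) + 1) / 2 ^ l) (k / 2 ^ l) - g l k w =
        (iterInt φ w (((k : ℝ) + 1) / 2 ^ l) (k / 2 ^ l) -
          chenMul (g (l + 1) (2 * k + 1)) (g (l + 1) (2 * k)) w) +
        (chenMul (g (l + 1) (2 * k + 1)) (g (l + 1) (2 * k)) w - g l k w) by ring, h1, ← h5]
      exact (abs_add_le _ _).trans (add_le_add ((abs_add_le _ _).trans (add_le_add h3 h4)) h2)

/-- Paths realising a matched dyadic system are Hölder, uniformly in the scale. -/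
lemma exists_holder_of_realizesDyadic {C q β : ℝ} {g : ℕ → ℕ → List (Fin d) → ℝ}
    (hβ0 : 0 < β) (hβ1 : β ≤ 1)
    (hq : ∀ l : ℕ, q ^ l = (1 / (2 : ℝ) ^ l) ^ β) (hq0 : 0 < q) (hq1 : q < 1) (hC : 0 ≤ C)
    (hg : ∀ m k, Reachable (C * q ^ m) (g m k)) {K : ℕ} (hK : 2 * q ^ (K + 1) < 1)
    (hgm : DyadicMatched K g) :
    ∃ H : ℝ, 0 ≤ H ∧ ∀ m φ, RealizesDyadic C q g m φ → ∀ w : List (Fin d), w.length ≤ K + 1 →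
      ∀ t s : ℝ, |iterInt φ w t s| ≤ (H * |t - s| ^ β) ^ w.length := by
  have hQ1 : 0 < 1 - 2 * q ^ (K + 1) := by linarith
  set B := 2 * (4 * C) ^ (K + 1) / (1 - 2 * q ^ (K + 1)) with hB
  have hB0 : 0 ≤ B := by positivity
  set A := C + (B ⊔ 1) with hA
  have hA0 : 0 ≤ A := by positivity
  have hCA : C ≤ A := by
    have : 0 ≤ B ⊔ 1 := by positivity
    linarith
  have hq1' : 0 < 1 - q := by linarith
  set H := 3 * (A / (1 - q)) with hH
  have hH0 : 0 ≤ H := by positivity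
  refine ⟨2 * H, by positivity, fun m φ hφ => ?_⟩
  have main : ∀ s t : ℝ, 0 ≤ s → s ≤ t → t ≤ 1 → 0 ≤ H * (t - s) ^ β ∧
      ∀ w : List (Fin d), w.length ≤ K + 1 → |iterInt φ w t s| ≤ (H * (t - s) ^ β) ^ w.length := by
    refine holder_of_dyadic hβ0 hq0 hq1 hq hA0 m (fun s t r => 0 ≤ r ∧
      ∀ w : List (Fin d), w.length ≤ K + 1 → |iterInt φ w t s| ≤ r ^ w.length) ?_ ?_ ?_ ?_
    · exact fun s t r r' h hr => ⟨h.1.trans hr, fun w hw => (h.2 w hw).trans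
        (pow_le_pow_left₀ h.1 hr _)⟩
    · refine fun s u t r r' h h' => ⟨add_nonneg h.1 h'.1, fun w hw => ?_⟩
      rw [iterInt_chen hφ.continuous w t u s, add_comm r]
      exact abs_chenMul_le h'.1 h.1 h'.2 h.2 w hw
    · intro l hl k hk
      have hql : 0 < q ^ l := by positivity
      refine ⟨by positivity, fun w hw => ?_⟩
      obtain ⟨h1, h2⟩ := hφ.coarse hq0 hq1 hC hg hK hgm l hl k hk w
      have h3 := (hg l k).abs_le w
      rcases hw.lt_or_eq with hw | hw
      · rw [h1 (by omega)]
        exact h3.trans (by gcongr)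
      · have h4 : B * (q ^ (K + 1)) ^ l ≤ ((B ⊔ 1) * q ^ l) ^ (K + 1) := by
          rw [mul_pow, ← pow_mul, ← pow_mul, mul_comm l]
          gcongr
          exact (le_max_left _ _).trans (le_self_pow₀ (le_max_right _ _) (by omega))
        have h5 := pow_add_pow_le (x := C * q ^ l) (y := (B ⊔ 1) * q ^ l) (by positivity)
          (by positivity) (n := K + 1) (by omega)
        rw [hw] at h3 ⊢
        rw [hA, add_mul]
        have h6 := abs_sub_abs_le_abs_sub (iterInt φ w (((k : ℝ) + 1) / 2 ^ l) (k / 2 ^ l)) (g l k w)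
        linarith [h2 hw]
    · intro s t hst hm
      have hts : 0 ≤ t - s := by linarith
      refine ⟨by positivity, fun w hw => (abs_iterInt_le hφ.norm_le w t s).trans ?_⟩
      rw [abs_of_nonneg hts]
      have h2m : (0 : ℝ) < 2 ^ m := by positivity
      have hqm : 0 < q ^ m := by positivity
      have key : 2 ^ m * q ^ m * (t - s) ≤ (t - s) ^ β := by
        rcases hts.eq_or_lt with h0 | h0
        · rw [← h0, mul_zero]
          positivity
        calc 2 ^ m * q ^ m * (t - s) = 2 ^ m * q ^ m * ((t - s) ^ β * (t - s) ^ (1 - β)) := by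
              rw [← Real.rpow_add h0, add_sub_cancel, Real.rpow_one]
          _ ≤ 2 ^ m * q ^ m * ((t - s) ^ β * (1 / 2 ^ m) ^ (1 - β)) := by
              have := Real.rpow_le_rpow hts hm (show 0 ≤ 1 - β by linarith)
              gcongr
          _ = (2 ^ m * ((1 / 2 ^ m) ^ β * (1 / 2 ^ m) ^ (1 - β))) * (t - s) ^ β := by
              rw [hq]
              ring
          _ = (t - s) ^ β := by
              rw [← Real.rpow_add (by positivity), add_sub_cancel, Real.rpow_one,
                mul_one_div_cancel h2m.ne', one_mul]
      refine pow_le_pow_left₀ (by positivity) ?_ _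
      calc 2 ^ m * (C * q ^ m) * (t - s) = C * (2 ^ m * q ^ m * (t - s)) := by ring
        _ ≤ C * (t - s) ^ β := by gcongr
        _ ≤ A * (t - s) ^ β := by gcongr
  intro w hw t s
  have hc : ∀ x : ℝ, 0 ≤ max 0 (min 1 x) ∧ max 0 (min 1 x) ≤ 1 := fun x =>
    ⟨le_max_left _ _, max_le zero_le_one (min_le_left _ _)⟩
  have hcts : |max 0 (min 1 t) - max 0 (min 1 s)| ≤ |t - s| :=
    (abs_max_sub_max_le_max _ _ _ _).trans (by
      simpa using ((abs_min_sub_min_le_max 1 t 1 s).trans (by simp)))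
  rw [iterInt_clamp hφ.continuous hφ.eq_zero w t s]
  set t' := max 0 (min 1 t)
  set s' := max 0 (min 1 s)
  have hr : (H * |t' - s'| ^ β) ≤ H * |t - s| ^ β := by gcongr
  have hr0 : 0 ≤ H * |t' - s'| ^ β := by positivity
  rcases le_total s' t' with h | h
  · have := (main s' t' (hc s).1 h (hc t).2).2 w hw
    rw [← abs_of_nonneg (sub_nonneg.2 h)] at this
    exact this.trans (pow_le_pow_left₀ hr0 (by linarith) _)
  · have h1 := main t' s' (hc t).1 h (hc s).2
    rw [← abs_of_nonneg (sub_nonneg.2 h), abs_sub_comm] at h1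
    have := abs_iterInt_swap_le hφ.continuous (n := K + 1) h1.2 h1.1 w hw
    exact this.trans (pow_le_pow_left₀ (by positivity) (by linarith) _)

end DyadicPaths

section Convergence

variable {d : ℕ}

lemma abs_mul_sub_mul_le_add (a b a' b' : ℝ) :
    |a' * b' - a * b| ≤ |a' - a| * |b'| + |a| * |b' - b| := by
  rw [← abs_mul, ← abs_mul, show a' * b' - a * b = (a' - a) * b' + a * (b' - b) by ring]
  exact abs_add_le _ _

/-- A Hölder bound and compact support give a uniform bound. -/
lemma abs_iterInt_le_of_holder {f : ℝ → Fin d → ℝ} (hf : Continuous f)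
    (hf0 : ∀ x, x ∉ Set.Ioo (0 : ℝ) 1 → f x = 0) {n : ℕ} {H β : ℝ} (hβ : 0 ≤ β) (hH : 1 ≤ H)
    (h : ∀ w : List (Fin d), w.length ≤ n → ∀ t s : ℝ,
      |iterInt f w t s| ≤ (H * |t - s| ^ β) ^ w.length)
    (w : List (Fin d)) (hw : w.length ≤ n) (t s : ℝ) : |iterInt f w t s| ≤ H ^ n := by
  rw [iterInt_clamp hf hf0]
  have hts : |max 0 (min 1 t) - max 0 (min 1 s)| ≤ 1 := by
    rw [abs_le]
    constructor <;>
      linarith [le_max_left 0 (min 1 t), le_max_left 0 (min 1 s),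
        max_le zero_le_one (min_le_left 1 t), max_le zero_le_one (min_le_left 1 s)]
  refine (h w hw _ _).trans ((pow_le_pow_left₀ (by positivity) ?_ _).trans
    (pow_le_pow_right₀ hH hw))
  exact mul_le_of_le_one_right (by linarith) (Real.rpow_le_one (abs_nonneg _) hts hβ)

/-- Realisations at different scales almost agree at dyadic points. -/
lemma RealizesDyadic.abs_sub_le {C q : ℝ} {g : ℕ → ℕ → List (Fin d) → ℝ} {m m' : ℕ}
    {φ φ' : ℝ → Fin d → ℝ} (hφ : RealizesDyadic C q g m φ) (hφ' : RealizesDyadic C q g m' φ')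
    (hm : m ≤ m') (hq0 : 0 < q) (hq1 : q < 1) (hC : 0 ≤ C)
    (hg : ∀ m k, Reachable (C * q ^ m) (g m k)) {K : ℕ} (hK : 2 * q ^ (K + 1) < 1)
    (hgm : DyadicMatched K g) : ∀ k : ℕ, k ≤ 2 ^ m → ∀ w : List (Fin d),
      (w.length ≤ K → iterInt φ' w ((k : ℝ) / 2 ^ m) 0 = iterInt φ w ((k : ℝ) / 2 ^ m) 0) ∧
      (w.length ≤ K + 1 → |iterInt φ' w ((k : ℝ) / 2 ^ m) 0 - iterInt φ w ((k : ℝ) / 2 ^ m) 0| ≤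
        k * (2 * (4 * C) ^ (K + 1) / (1 - 2 * q ^ (K + 1)) * (q ^ (K + 1)) ^ m)) := by
  have hQ1 : 0 < 1 - 2 * q ^ (K + 1) := by linarith
  intro k
  induction k with
  | zero =>
    intro _ w
    rcases eq_or_ne w [] with rfl | hw
    · simp
    · simp [iterInt_self w hw]
  | succ k ih =>
    intro hk w
    have hc' := iterInt_chen hφ'.continuous w ((k + 1 : ℕ) / 2 ^ m : ℝ) (k / 2 ^ m) 0
    have hc := iterInt_chen hφ.continuous w ((k + 1 : ℕ) / 2 ^ m : ℝ) (k / 2 ^ m) 0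
    push_cast at hc hc' ⊢
    have hcoarse := hφ'.coarse hq0 hq1 hC hg hK hgm m hm k (by omega)
    have hexact := hφ.iterInt_eq k (by omega)
    have hlow : w.length ≤ K →
        iterInt φ' w (((k : ℝ) + 1) / 2 ^ m) 0 = iterInt φ w (((k : ℝ) + 1) / 2 ^ m) 0 := by
      intro hw
      rw [hc, hc']
      refine chenMul_congr (fun v hv => ?_) fun v hv => (ih (by omega) v).1 (hv.trans hw)
      rw [hexact, (hcoarse v).1 (hv.trans hw)]
    refine ⟨hlow, fun hw => ?_⟩
    rcases hw.lt_or_eq with hw' | hw'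
    · rw [hlow (by omega), sub_self, abs_zero]
      positivity
    · have hw0 : w ≠ [] := by
        rintro rfl
        simp at hw'
      rw [hc, hc', chenMul_sub_chenMul hw0
        (fun v hv => ((hcoarse v).1 (by omega)).trans (hexact v).symm)
        fun v hv => (ih (by omega) v).1 (by omega)]
      rw [iterInt_nil, iterInt_nil, mul_one, one_mul, hexact, add_comm, add_one_mul]
      exact (abs_add_le _ _).trans (add_le_add ((ih (by omega) w).2 hw) ((hcoarse w).2 hw'))

lemma abs_iterInt_sub_le {f : ℝ → Fin d → ℝ} (hf : Continuous f) {n : ℕ} {H B x t u s : ℝ}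
    (hH : 1 ≤ H) (hx0 : 0 ≤ x) (hx1 : x ≤ 1) (hB : 0 ≤ B)
    (hsmall : ∀ w : List (Fin d), w.length ≤ n → |iterInt f w t u| ≤ (H * x) ^ w.length)
    (hbound : ∀ w : List (Fin d), w.length ≤ n → |iterInt f w u s| ≤ B)
    (w : List (Fin d)) (hw : w.length ≤ n) :
    |iterInt f w t s - iterInt f w u s| ≤ n * (H ^ n * B) * x := by
  rw [iterInt_chen hf w t u s, chenMul, Finset.sum_range_succ', List.take_zero, List.drop_zero,
    iterInt_nil, one_mul, add_sub_cancel_right]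
  have hterm : ∀ k ∈ Finset.range w.length,
      |iterInt f (w.take (k + 1)) t u * iterInt f (w.drop (k + 1)) u s| ≤ H ^ n * B * x := by
    intro k hk
    rw [Finset.mem_range] at hk
    have h1 := hsmall (w.take (k + 1)) (by rw [List.length_take]; omega)
    have h2 := hbound (w.drop (k + 1)) (by rw [List.length_drop]; omega)
    rw [List.length_take, min_eq_left (by omega : k + 1 ≤ w.length), mul_pow] at h1
    have h3 : H ^ (k + 1) * x ^ (k + 1) ≤ H ^ n * x :=
      mul_le_mul (pow_le_pow_right₀ hH (by omega)) (pow_le_of_le_one hx0 hx1 (by omega))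
        (by positivity) (by positivity)
    rw [abs_mul, mul_right_comm]
    exact mul_le_mul (h1.trans h3) h2 (abs_nonneg _) (by positivity)
  refine (Finset.abs_sum_le_sum_abs _ _).trans ((Finset.sum_le_sum hterm).trans ?_)
  rw [Finset.sum_const, Finset.card_range, nsmul_eq_mul, mul_assoc (n : ℝ)]
  gcongr

/-- The realisations of a matched dyadic system converge geometrically. -/
lemma exists_geometric_rate {C q β : ℝ} {g : ℕ → ℕ → List (Fin d) → ℝ}
    (hβ0 : 0 < β) (hβ1 : β ≤ 1)
    (hq : ∀ l : ℕ, q ^ l = (1 / (2 : ℝ) ^ l) ^ β) (hq0 : 0 < q) (hq1 : q < 1) (hC : 0 ≤ C)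
    (hg : ∀ m k, Reachable (C * q ^ m) (g m k)) {K : ℕ} (hK : 2 * q ^ (K + 1) < 1)
    (hgm : DyadicMatched K g) :
    ∃ D ρ : ℝ, 0 ≤ D ∧ 0 ≤ ρ ∧ ρ < 1 ∧ ∀ m m' φ φ', m ≤ m' → RealizesDyadic C q g m φ →
      RealizesDyadic C q g m' φ' → ∀ w : List (Fin d), w.length ≤ K + 1 → ∀ t s : ℝ,
        |iterInt φ' w t s - iterInt φ w t s| ≤ D * ρ ^ m := by
  obtain ⟨H₀, hH₀, hhol⟩ := exists_holder_of_realizesDyadic hβ0 hβ1 hq hq0 hq1 hC hg hK hgm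
  set H := H₀ ⊔ 1 with hH
  have hH1 : 1 ≤ H := le_max_right _ _
  have hhol' : ∀ m φ, RealizesDyadic C q g m φ → ∀ w : List (Fin d), w.length ≤ K + 1 →
      ∀ t s : ℝ, |iterInt φ w t s| ≤ (H * |t - s| ^ β) ^ w.length := fun m φ h w hw t s =>
    (hhol m φ h w hw t s).trans (by gcongr; exact le_max_left _ _)
  set B := H ^ (K + 1) with hB
  have hB0 : 0 ≤ B := by positivity
  have hbdd : ∀ m φ, RealizesDyadic C q g m φ → ∀ w : List (Fin d), w.length ≤ K + 1 →
      ∀ t s : ℝ, |iterInt φ w t s| ≤ B := fun m φ h =>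
    abs_iterInt_le_of_holder h.continuous h.eq_zero hβ0.le hH1 (hhol' m φ h)
  set ρ := q ⊔ 2 * q ^ (K + 1) with hρ
  have hρ0 : 0 ≤ ρ := hq0.le.trans (le_max_left _ _)
  have hQ1 : 0 < 1 - 2 * q ^ (K + 1) := by linarith
  set D₀ := 2 * (4 * C) ^ (K + 1) / (1 - 2 * q ^ (K + 1)) with hD₀
  have hD₀0 : 0 ≤ D₀ := by positivity
  set E := ((K + 1 : ℕ) : ℝ) * (H ^ (K + 1) * B) with hE
  have hE0 : 0 ≤ E := by positivity
  have base01 : ∀ m m' φ φ', m ≤ m' → RealizesDyadic C q g m φ →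
      RealizesDyadic C q g m' φ' → ∀ w : List (Fin d), w.length ≤ K + 1 → ∀ t : ℝ, 0 ≤ t → t ≤ 1 →
        |iterInt φ' w t 0 - iterInt φ w t 0| ≤ (2 * E + D₀) * ρ ^ m := by
    intro m m' φ φ' hm h h' w hw t ht0 ht1
    have h2 : (0 : ℝ) < 2 ^ m := by positivity
    set k := ⌊t * 2 ^ m⌋₊ with hk
    have hk1 : (k : ℝ) / 2 ^ m ≤ t := by
      rw [div_le_iff₀ h2]
      exact Nat.floor_le (by positivity)
    have hk2 : t ≤ (k : ℝ) / 2 ^ m + 1 / 2 ^ m := by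
      rw [← add_div, le_div_iff₀ h2]
      exact (Nat.lt_floor_add_one _).le
    have hk3 : k ≤ 2 ^ m := by
      have := (div_le_one h2).1 (hk1.trans ht1)
      exact_mod_cast this
    have hsmall : |t - k / 2 ^ m| ^ β ≤ q ^ m := by
      rw [hq, abs_of_nonneg (by linarith)]
      exact Real.rpow_le_rpow (by linarith) (by linarith) hβ0.le
    have hx1 : q ^ m ≤ 1 := pow_le_one₀ hq0.le hq1.le
    have near : ∀ n ψ, RealizesDyadic C q g n ψ →
        |iterInt ψ w t 0 - iterInt ψ w (k / 2 ^ m) 0| ≤ E * q ^ m := fun n ψ hψ =>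
      abs_iterInt_sub_le hψ.continuous hH1 (by positivity) hx1 hB0
        (fun v hv => (hhol' n ψ hψ v hv _ _).trans (by gcongr))
        (fun v hv => hbdd n ψ hψ v hv _ _) w hw
    have dy := (h.abs_sub_le h' hm hq0 hq1 hC hg hK hgm k hk3 w).2 hw
    have dy' : k * (D₀ * (q ^ (K + 1)) ^ m) ≤ D₀ * ρ ^ m := by
      have h3 : (k : ℝ) ≤ 2 ^ m := by exact_mod_cast hk3
      calc k * (D₀ * (q ^ (K + 1)) ^ m) ≤ 2 ^ m * (D₀ * (q ^ (K + 1)) ^ m) := by gcongr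
        _ = D₀ * (2 * q ^ (K + 1)) ^ m := by rw [mul_pow]; ring
        _ ≤ D₀ * ρ ^ m := by
          gcongr
          exact le_max_right _ _
    have hqρ : E * q ^ m ≤ E * ρ ^ m := by
      gcongr
      exact le_max_left _ _
    have n1 := near m φ h
    have n2 := near m' φ' h'
    rw [abs_le] at n1 n2 dy ⊢
    constructor <;> linarith [n1.1, n1.2, n2.1, n2.2, dy.1, dy.2]
  have base : ∀ m m' φ φ', m ≤ m' → RealizesDyadic C q g m φ →
      RealizesDyadic C q g m' φ' → ∀ w : List (Fin d), w.length ≤ K + 1 → ∀ t : ℝ,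
        |iterInt φ' w t 0 - iterInt φ w t 0| ≤ (2 * E + D₀) * ρ ^ m := by
    intro m m' φ φ' hm h h' w hw t
    rw [iterInt_clamp h.continuous h.eq_zero, iterInt_clamp h'.continuous h'.eq_zero]
    simp only [min_eq_right zero_le_one, max_self]
    exact base01 m m' φ φ' hm h h' w hw _ (le_max_left _ _) (max_le zero_le_one (min_le_left _ _))
  set D₁ := 2 * E + D₀ with hD₁
  have hD₁0 : 0 ≤ D₁ := by positivity
  suffices ∀ n : ℕ, n ≤ K + 1 → ∃ D : ℝ, 0 ≤ D ∧ ∀ m m' φ φ', m ≤ m' → RealizesDyadic C q g m φ →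
      RealizesDyadic C q g m' φ' → ∀ w : List (Fin d), w.length ≤ n → ∀ t s : ℝ,
        |iterInt φ' w t s - iterInt φ w t s| ≤ D * ρ ^ m by
    obtain ⟨D, hD, h⟩ := this (K + 1) le_rfl
    exact ⟨D, ρ, hD, hρ0, max_lt hq1 hK, h⟩
  intro n
  induction n with
  | zero =>
    refine fun _ => ⟨0, le_rfl, fun m m' φ φ' _ _ _ w hw t s => ?_⟩
    obtain rfl : w = [] := List.length_eq_zero_iff.1 (by omega)
    simp
  | succ n ih =>
    intro hn
    obtain ⟨D, hD, h⟩ := ih (by omega)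
    refine ⟨D + (D₁ + (n + 1 : ℕ) * (D * B + B * D₁)), by positivity,
      fun m m' φ φ' hm hφ hφ' w hw t s => ?_⟩
    rcases hw.lt_or_eq with hw' | hw'
    · refine (h m m' φ φ' hm hφ hφ' w (by omega) t s).trans ?_
      gcongr
      exact le_add_of_nonneg_right (by positivity)
    have split : ∀ ψ : ℝ → Fin d → ℝ, Continuous ψ → iterInt ψ w t s = iterInt ψ w t 0 -
        ∑ k ∈ Finset.range (n + 1), iterInt ψ (w.take k) t s * iterInt ψ (w.drop k) s 0 :=
      fun ψ hψ => by
        have := iterInt_chen hψ w t s 0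
        rw [chenMul, Finset.sum_range_succ, List.take_length, List.drop_length, iterInt_nil,
          mul_one, hw'] at this
        linarith
    have hterm : ∀ k ∈ Finset.range (n + 1),
        |iterInt φ' (w.take k) t s * iterInt φ' (w.drop k) s 0 -
          iterInt φ (w.take k) t s * iterInt φ (w.drop k) s 0| ≤ (D * B + B * D₁) * ρ ^ m := by
      intro k hk
      rw [Finset.mem_range] at hk
      have l1 : (w.take k).length ≤ n := by rw [List.length_take]; omega
      have l2 : (w.drop k).length ≤ K + 1 := by rw [List.length_drop]; omega
      refine (abs_mul_sub_mul_le_add _ _ _ _).trans ?_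
      have a1 := h m m' φ φ' hm hφ hφ' _ l1 t s
      have a2 := hbdd m' φ' hφ' _ l2 s 0
      have a3 := hbdd m φ hφ (w.take k) (by omega) t s
      have a4 := base m m' φ φ' hm hφ hφ' _ l2 s
      have a5 := mul_le_mul a1 a2 (abs_nonneg _) (by positivity)
      have a6 := mul_le_mul a3 a4 (abs_nonneg _) hB0
      linarith
    rw [split φ hφ.continuous, split φ' hφ'.continuous]
    have a1 := base m m' φ φ' hm hφ hφ' w (by omega) t
    have a2 := (Finset.abs_sum_le_sum_abs _ _).trans (Finset.sum_le_sum hterm)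
    rw [Finset.sum_sub_distrib, Finset.sum_const, Finset.card_range, nsmul_eq_mul] at a2
    have a3 : 0 ≤ D * ρ ^ m := by positivity
    rw [abs_le] at a1 a2 ⊢
    constructor <;> linarith [a1.1, a1.2, a2.1, a2.2]

/-- Interpolation between a Hölder bound and uniform convergence. -/
lemma exists_forall_abs_sub_le_rpow {a : ℕ → ℝ → ℝ → ℝ} {b : ℝ → ℝ → ℝ} {C D ρ θ θ' : ℝ}
    (hθ : θ' < θ) (hθ' : 0 ≤ θ') (hD : 0 ≤ D) (hρ0 : 0 ≤ ρ) (hρ1 : ρ < 1) (hC : 0 ≤ C)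
    (hhol : ∀ m t s, |a m t s - b t s| ≤ C * |t - s| ^ θ)
    (hunif : ∀ m t s, |a m t s - b t s| ≤ D * ρ ^ m) {ε : ℝ} (hε : 0 < ε) :
    ∃ M : ℕ, ∀ m : ℕ, M ≤ m → ∀ s t : ℝ, s ≠ t → |a m t s - b t s| ≤ ε * |t - s| ^ θ' := by
  have hδ : 0 < θ - θ' := by linarith
  obtain ⟨η, hη, hηC⟩ : ∃ η : ℝ, 0 < η ∧ C * η ^ (θ - θ') ≤ ε := by
    refine ⟨(ε / (C + 1)) ^ (1 / (θ - θ')), by positivity, ?_⟩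
    rw [← Real.rpow_mul (by positivity), one_div_mul_cancel hδ.ne', Real.rpow_one,
      mul_div_assoc', div_le_iff₀ (by positivity)]
    nlinarith
  obtain ⟨M, hM⟩ : ∃ M : ℕ, D * ρ ^ M ≤ ε * η ^ θ' := by
    have hlim : Filter.Tendsto (fun M : ℕ => D * ρ ^ M) Filter.atTop (nhds (D * 0)) :=
      (tendsto_pow_atTop_nhds_zero_of_lt_one hρ0 hρ1).const_mul D
    rw [mul_zero] at hlim
    exact ((hlim.eventually_lt_const (show 0 < ε * η ^ θ' by positivity)).exists).imp
      fun _ h => h.le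
  refine ⟨M, fun m hm s t hst => ?_⟩
  have hts : 0 < |t - s| := abs_pos.2 (sub_ne_zero.2 hst.symm)
  rcases le_or_gt |t - s| η with h | h
  · refine (hhol m t s).trans ?_
    calc C * |t - s| ^ θ = C * |t - s| ^ (θ - θ') * |t - s| ^ θ' := by
          rw [mul_assoc, ← Real.rpow_add hts, sub_add_cancel]
      _ ≤ C * η ^ (θ - θ') * |t - s| ^ θ' := by gcongr
      _ ≤ ε * |t - s| ^ θ' := by gcongr
  · calc |a m t s - b t s| ≤ D * ρ ^ m := hunif m t s
      _ ≤ D * ρ ^ M := mul_le_mul_of_nonneg_left (pow_le_pow_of_le_one hρ0 hρ1.le hm) hD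
      _ ≤ ε * η ^ θ' := hM
      _ ≤ ε * |t - s| ^ θ' := by gcongr

end Convergence

section Lift

variable {d : ℕ}

/-- A path with velocity realising the increments of `γ` agrees with `γ` at dyadic points. -/
lemma RealizesDyadic.iterInt_singleton {C q : ℝ} {g : ℕ → ℕ → List (Fin d) → ℝ} {m : ℕ}
    {φ : ℝ → Fin d → ℝ} (hφ : RealizesDyadic C q g m φ) {γ : ℝ → Fin d → ℝ} (hγ : γ 0 = 0)
    (hg : ∀ k i, g m k [i] = γ (((k : ℝ) + 1) / 2 ^ m) i - γ (k / 2 ^ m) i) (i : Fin d) :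
    ∀ k : ℕ, k ≤ 2 ^ m → iterInt φ [i] (k / 2 ^ m) 0 = γ (k / 2 ^ m) i := by
  intro k
  induction k with
  | zero => simp [iterInt_self, hγ]
  | succ k ih =>
    intro hk
    have h := iterInt_chen hφ.continuous [i] ((k + 1 : ℕ) / 2 ^ m : ℝ) (k / 2 ^ m) 0
    rw [chenMul_singleton, iterInt_nil, iterInt_nil, one_mul, mul_one, ih (by omega)] at h
    push_cast at h ⊢
    rw [h, hφ.iterInt_eq k (by omega), hg]
    ring

lemma exists_lift_unitInterval {β A : ℝ} {K : ℕ} (hβ0 : 0 < β) (hβ1 : β ≤ 1) (hK0 : K ≠ 0)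
    (hK : K * β < 1) (hK' : 1 < (K + 1) * β) (hA : 0 ≤ A) (γ : ℝ → Fin d → ℝ)
    (hγ0 : ∀ x, x ∉ Set.Ioo (0 : ℝ) 1 → γ x = 0)
    (hγ : ∀ s t, |t - s| ≤ 1 → ‖γ t - γ s‖ ≤ A * |t - s| ^ β) :
    ∃ (φ : ℕ → ℝ → Fin d → ℝ) (X : List (Fin d) → ℝ → ℝ → ℝ) (H D ρ : ℝ),
      0 ≤ H ∧ 0 ≤ D ∧ 0 ≤ ρ ∧ ρ < 1 ∧ (∀ m, Continuous (φ m)) ∧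
      (∀ m x, x ∉ Set.Ioo (0 : ℝ) 1 → φ m x = 0) ∧ (∀ m i, iterInt (φ m) [i] 1 0 = 0) ∧
      (∀ i t s, X [i] t s = γ t i - γ s i) ∧
      (∀ m w, w.length ≤ K + 1 → ∀ t s,
        |iterInt (φ m) w t s| ≤ (H * |t - s| ^ β) ^ w.length) ∧
      ∀ m w, w.length ≤ K + 1 → ∀ t s, |iterInt (φ m) w t s - X w t s| ≤ D * ρ ^ m := by
  set q : ℝ := (1 / 2) ^ β with hq_def
  have hq0 : 0 < q := by positivity
  have hq1 : q < 1 := Real.rpow_lt_one (by norm_num) (by norm_num) hβ0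
  have hq : ∀ l : ℕ, q ^ l = (1 / (2 : ℝ) ^ l) ^ β := fun l => by
    rw [hq_def, Real.rpow_pow_comm (by norm_num), one_div_pow]
  have hqK : 1 < 2 * q ^ K := by
    have : (1 / 2 : ℝ) ^ (1 : ℝ) < (1 / 2) ^ (β * K) :=
      Real.rpow_lt_rpow_of_exponent_gt (by norm_num) (by norm_num) (by linarith)
    rw [Real.rpow_one, Real.rpow_mul (by norm_num), Real.rpow_natCast] at this
    linarith
  have hqK' : 2 * q ^ (K + 1) < 1 := by
    have : (1 / 2 : ℝ) ^ (β * ((K + 1 : ℕ) : ℝ)) < (1 / 2) ^ (1 : ℝ) :=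
      Real.rpow_lt_rpow_of_exponent_gt (by norm_num) (by norm_num) (by push_cast; linarith)
    rw [Real.rpow_one, Real.rpow_mul (by norm_num), Real.rpow_natCast] at this
    linarith
  obtain ⟨C, g, hC, hg, hgm, hga⟩ := exists_dyadicMatched hK0 hq0 hq1 hqK hA
    (fun m k => γ (((k : ℝ) + 1) / 2 ^ m) - γ (k / 2 ^ m)) (fun m k => by
      have h2 : (0 : ℝ) < 1 / 2 ^ m := by positivity
      have e : |((k : ℝ) + 1) / 2 ^ m - k / 2 ^ m| = 1 / 2 ^ m := by
        rw [← sub_div, add_sub_cancel_left, abs_of_pos h2]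
      rw [hq, ← e]
      refine hγ _ _ ?_
      rw [e]
      exact div_le_one_of_le₀ (one_le_pow₀ one_le_two) (by positivity)) (fun m k => by
      have e0 : ((2 * k : ℕ) : ℝ) / 2 ^ (m + 1) = k / 2 ^ m := by
        push_cast
        field_simp
        ring
      have e1 : (((2 * k : ℕ) : ℝ) + 1) / 2 ^ (m + 1) = ((2 * k + 1 : ℕ) : ℝ) / 2 ^ (m + 1) := by
        push_cast
        rfl
      have e2 : (((2 * k + 1 : ℕ) : ℝ) + 1) / 2 ^ (m + 1) = (k + 1) / 2 ^ m := by
        push_cast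
        field_simp
        ring
      rw [e0, e1, e2]
      abel)
  choose φ hφ using exists_realizesDyadic g hg
  obtain ⟨H, hH, hhol⟩ := exists_holder_of_realizesDyadic hβ0 hβ1 hq hq0 hq1 hC hg hqK' hgm
  obtain ⟨D, ρ, hD, hρ0, hρ1, hrate⟩ := exists_geometric_rate hβ0 hβ1 hq hq0 hq1 hC hg hqK' hgm
  have hDρ : Filter.Tendsto (fun m : ℕ => D * ρ ^ m) Filter.atTop (nhds 0) := by
    simpa using (tendsto_pow_atTop_nhds_zero_of_lt_one hρ0 hρ1).const_mul D
  have hlim : ∀ (w : List (Fin d)) (t s : ℝ), ∃ x : ℝ, w.length ≤ K + 1 →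
      Filter.Tendsto (fun m => iterInt (φ m) w t s) Filter.atTop (nhds x) := fun w t s => by
    by_cases hw : w.length ≤ K + 1
    · obtain ⟨x, hx⟩ := cauchySeq_tendsto_of_complete
        (u := fun m => iterInt (φ m) w t s) (cauchySeq_of_le_tendsto_0' _ (fun m m' hm => by
          rw [dist_comm, Real.dist_eq]
          exact hrate m m' _ _ hm (hφ m) (hφ m') w hw t s) hDρ)
      exact ⟨x, fun _ => hx⟩
    · exact ⟨0, fun h => absurd h hw⟩
  choose X hX using hlim
  have h1 : γ 1 = 0 := hγ0 1 (by simp)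
  have h0 : γ 0 = 0 := hγ0 0 (by simp)
  have hexact := fun m => (hφ m).iterInt_singleton h0 fun k i => hga m k i
  have hX01 : ∀ i t, 0 ≤ t → t ≤ 1 → X [i] t 0 = γ t i := by
    intro i t ht0 ht1
    refine tendsto_nhds_unique (hX [i] t 0 (by simp)) ?_
    have hq' : Filter.Tendsto (fun m : ℕ => (H + A) * q ^ m) Filter.atTop (nhds 0) := by
      simpa using (tendsto_pow_atTop_nhds_zero_of_lt_one hq0.le hq1).const_mul (H + A)
    refine tendsto_iff_dist_tendsto_zero.2 (squeeze_zero (fun _ => dist_nonneg) (fun m => ?_) hq')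
    have h2 : (0 : ℝ) < 2 ^ m := by positivity
    set k := ⌊t * 2 ^ m⌋₊ with hk
    have hk1 : (k : ℝ) / 2 ^ m ≤ t := by
      rw [div_le_iff₀ h2]
      exact Nat.floor_le (by positivity)
    have hk2 : t ≤ (k : ℝ) / 2 ^ m + 1 / 2 ^ m := by
      rw [← add_div, le_div_iff₀ h2]
      exact (Nat.lt_floor_add_one _).le
    have hk3 : k ≤ 2 ^ m := by
      have := (div_le_one h2).1 (hk1.trans ht1)
      exact_mod_cast this
    have hsmall : |t - k / 2 ^ m| ^ β ≤ q ^ m := by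
      rw [hq, abs_of_nonneg (by linarith)]
      exact Real.rpow_le_rpow (by linarith) (by linarith) hβ0.le
    have a1 : |γ t i - γ (k / 2 ^ m) i| ≤ A * q ^ m := by
      have a2 := (norm_le_pi_norm (γ t - γ (k / 2 ^ m)) i).trans (hγ _ _ (by
        rw [abs_of_nonneg (by linarith)]
        have : 0 ≤ (k : ℝ) / 2 ^ m := by positivity
        linarith))
      exact a2.trans (by gcongr)
    have a2 := hhol m _ (hφ m) [i] (by simp) t (k / 2 ^ m)
    have a3 := iterInt_chen (hφ m).continuous [i] t (k / 2 ^ m) 0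
    rw [chenMul_singleton, iterInt_nil, iterInt_nil, one_mul, mul_one, hexact m i k hk3] at a3
    rw [List.length_singleton, pow_one] at a2
    have a4 : H * |t - k / 2 ^ m| ^ β ≤ H * q ^ m := by gcongr
    rw [Real.dist_eq, a3]
    rw [abs_le] at a1 a2 ⊢
    constructor <;> linarith [a1.1, a1.2, a2.1, a2.2]
  have hX0 : ∀ i t, X [i] t 0 = γ t i := by
    intro i t
    have hc : X [i] t 0 = X [i] (max 0 (min 1 t)) 0 := by
      refine tendsto_nhds_unique (hX [i] t 0 (by simp)) ((hX [i] _ 0 (by simp)).congr fun m => ?_)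
      rw [iterInt_clamp (hφ m).continuous (hφ m).eq_zero _ t 0]
      simp
    rw [hc, hX01 i _ (le_max_left _ _) (max_le zero_le_one (min_le_left _ _))]
    rcases le_total t 0 with h | h
    · rw [min_eq_right (by linarith), max_eq_left h, h0, hγ0 t fun h' => h'.1.not_ge h]
    rcases le_total 1 t with h' | h'
    · rw [min_eq_left h', max_eq_right zero_le_one, h1, hγ0 t fun h'' => h''.2.not_ge h']
    · rw [min_eq_right h', max_eq_right h]
  refine ⟨φ, X, H, D, ρ, hH, hD, hρ0, hρ1, fun m => (hφ m).continuous, fun m => (hφ m).eq_zero,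
    fun m i => ?_, fun i t s => ?_, fun m w hw => hhol m _ (hφ m) w hw, fun m w hw t s => ?_⟩
  · have := hexact m i (2 ^ m) le_rfl
    push_cast at this
    rw [div_self (by positivity), h1] at this
    exact this
  · rw [← hX0 i t, ← hX0 i s]
    refine tendsto_nhds_unique (hX [i] t s (by simp))
      (((hX [i] t 0 (by simp)).sub (hX [i] s 0 (by simp))).congr fun m => ?_)
    have := iterInt_chen (hφ m).continuous [i] t s 0
    rw [chenMul_singleton, iterInt_nil, iterInt_nil, one_mul, mul_one] at this
    linarith
  · rw [abs_sub_comm]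
    refine le_of_tendsto ((hX w t s hw).sub_const _).abs ?_
    filter_upwards [Filter.eventually_ge_atTop m] with m' hm
    exact hrate m m' _ _ hm (hφ m) (hφ m') w hw t s

/-- Any Hölder exponent below `α` can be improved to a non-critical one. -/
lemma exists_noncritical_exponent {α α' : ℝ} (hα1 : α < 1) (hα'0 : 0 < α') (hα'α : α' < α) :
    ∃ (β : ℝ) (K : ℕ), α' < β ∧ β < α ∧ K ≠ 0 ∧ K * β < 1 ∧ 1 < (K + 1) * β ∧
      ⌊1 / α'⌋₊ ≤ K + 1 := by
  set N := ⌊1 / α'⌋₊ with hN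
  have h1 : (N : ℝ) * α' ≤ 1 := by
    have := Nat.floor_le (show 0 ≤ 1 / α' by positivity)
    rwa [← hN, le_div_iff₀ hα'0] at this
  have h2 : 1 < ((N : ℝ) + 1) * α' := by
    have := Nat.lt_floor_add_one (1 / α')
    rwa [← hN, div_lt_iff₀ hα'0] at this
  have hN1 : 1 ≤ N := Nat.le_floor (by
    rw [Nat.cast_one, le_div_iff₀ hα'0]
    linarith)
  suffices ∃ K : ℕ, K ≠ 0 ∧ K * α' < 1 ∧ N ≤ K + 1 ∧ ∀ β, α' < β → 1 < ((K : ℝ) + 1) * β by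
    obtain ⟨K, hK0, hK1, hK2, hK3⟩ := this
    have hKpos : (0 : ℝ) < K := by exact_mod_cast Nat.pos_of_ne_zero hK0
    obtain ⟨β, hβ1, hβ2⟩ := exists_between (lt_min hα'α ((lt_div_iff₀' hKpos).2 hK1))
    exact ⟨β, K, hβ1, hβ2.trans_le (min_le_left _ _), hK0,
      (lt_div_iff₀' hKpos).1 (hβ2.trans_le (min_le_right _ _)), hK3 β hβ1, hK2⟩
  have hN0 : (0 : ℝ) ≤ N := N.cast_nonneg
  rcases h1.lt_or_eq with h | h
  · exact ⟨N, by omega, h, by omega, fun β hβ => by nlinarith⟩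
  · have hN2 : N ≠ 1 := fun h' => by
      rw [h', Nat.cast_one] at h
      linarith
    refine ⟨N - 1, by omega, ?_, by omega, fun β hβ => ?_⟩
    · rw [Nat.cast_sub hN1]
      push_cast
      linarith
    · rw [Nat.cast_sub hN1]
      push_cast
      have : (0 : ℝ) < N := by exact_mod_cast hN1
      nlinarith

end Lift

section Main

variable {d : ℕ}

/-- The primitive of a rescaled velocity with vanishing total increments. -/
lemma primitive_properties {f : ℝ → Fin d → ℝ} (hf : Continuous f)
    (hf0 : ∀ x, x ∉ Set.Ioo (0 : ℝ) 1 → f x = 0) (hf1 : ∀ i, iterInt f [i] 1 0 = 0) {a b : ℝ}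
    (ha : 0 < a) :
    (ContDiff ℝ 1 fun t i => iterInt f [i] (a * t + b) 0) ∧
      (HasCompactSupport fun t i => iterInt f [i] (a * t + b) 0) ∧
      (fun x i => deriv (fun t => iterInt f [i] (a * t + b) 0) x) =
        fun x => a • f (a * x + b) := by
  have hd : ∀ i x, HasDerivAt (fun t => iterInt f [i] (a * t + b) 0) (a * f (a * x + b) i) x := by
    intro i x
    have h1 := hasDerivAt_iterInt_cons hf i [] (a * x + b) 0
    have h2 : HasDerivAt (fun t => a * t + b) a x := by
      simpa using ((hasDerivAt_id x).const_mul a).add_const b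
    refine (h1.comp x h2).congr_deriv ?_
    rw [iterInt_nil]
    ring
  refine ⟨contDiff_pi.2 fun i => contDiff_one_iff_deriv.2
    ⟨fun x => (hd i x).differentiableAt, ?_⟩, ?_, ?_⟩
  · rw [funext fun x => (hd i x).deriv]
    fun_prop
  · refine HasCompactSupport.intro (isCompact_Icc (a := -b / a) (b := (1 - b) / a)) fun x hx => ?_
    funext i
    rw [iterInt_clamp hf hf0]
    simp only [min_eq_right zero_le_one, max_self, Pi.zero_apply]
    rw [Set.mem_Icc, not_and_or, not_le, not_le, lt_div_iff₀ ha, div_lt_iff₀ ha] at hx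
    rcases hx with hx | hx
    · rw [min_eq_right (by linarith), max_eq_left (by linarith)]
      exact iterInt_self _ (by simp) _
    · rw [min_eq_left (by linarith), max_eq_right zero_le_one, hf1]
  · funext x i
    rw [(hd i x).deriv]
    rfl

lemma exists_smooth_approximation {α α' : ℝ} (hα1 : α < 1) (hα'0 : 0 < α')
    (hα'α : α' < α) (Γ : ℝ → Fin d → ℝ) (hsupp : HasCompactSupport Γ)
    (hHolder : ∃ C : ℝ, ∀ s t : ℝ, s ≠ t → ‖Γ t - Γ s‖ ≤ C * |t - s| ^ α) :
    ∃ (ψ Γseq : ℕ → ℝ → Fin d → ℝ) (X : List (Fin d) → ℝ → ℝ → ℝ),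
      (∀ m, Continuous (ψ m)) ∧
      (∀ m, (fun x i => deriv (fun y => Γseq m y i) x) = ψ m) ∧
      (∀ m, ContDiff ℝ 1 (Γseq m) ∧ HasCompactSupport (Γseq m)) ∧
      (∀ i t s, X [i] t s = Γ t i - Γ s i) ∧
      ∀ w : List (Fin d), w.length ≤ ⌊1 / α'⌋₊ →
        (∃ C : ℝ, ∀ s t : ℝ, s ≠ t → |X w t s| ≤ C * |t - s| ^ ((w.length : ℝ) * α')) ∧
        (∀ t s, Filter.Tendsto (fun m => iterInt (ψ m) w t s) Filter.atTop (nhds (X w t s))) ∧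
        (w ≠ [] → ∀ ε : ℝ, 0 < ε → ∃ M : ℕ, ∀ m : ℕ, M ≤ m → ∀ s t : ℝ, s ≠ t →
          |iterInt (ψ m) w t s - X w t s| ≤ ε * |t - s| ^ ((w.length : ℝ) * α')) := by
  obtain ⟨β, K, hβ, hβα, hK0, hK, hK', hN⟩ := exists_noncritical_exponent hα1 hα'0 hα'α
  have hβ0 : 0 < β := hα'0.trans hβ
  obtain ⟨C, hC⟩ := hHolder
  obtain ⟨R, hR1, hR⟩ : ∃ R : ℝ, 1 ≤ R ∧ ∀ x, R ≤ |x| → Γ x = 0 := by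
    obtain ⟨R₀, hR₀⟩ := hsupp.isCompact.isBounded.subset_closedBall (0 : ℝ)
    refine ⟨R₀ ⊔ 0 + 1, by linarith [le_max_right R₀ 0], fun x hx => ?_⟩
    refine image_eq_zero_of_notMem_tsupport fun h => ?_
    have := hR₀ h
    rw [mem_closedBall_zero_iff, Real.norm_eq_abs] at this
    linarith [le_max_left R₀ 0]
  set a : ℝ := 1 / (2 * R) with ha_def
  have ha : 0 < a := by positivity
  have ha1 : a ≤ 1 := div_le_one_of_le₀ (by linarith) (by positivity)
  have hγ0 : ∀ x, x ∉ Set.Ioo (0 : ℝ) 1 → Γ ((x - 1 / 2) / a) = 0 := fun x hx => by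
    refine hR _ ?_
    rw [ha_def, div_div_eq_mul_div, div_one, le_abs]
    rw [Set.mem_Ioo, not_and_or, not_lt, not_lt] at hx
    rcases hx with hx | hx
    · right
      nlinarith
    · left
      nlinarith
  have hγ : ∀ s t : ℝ, |t - s| ≤ 1 →
      ‖Γ ((t - 1 / 2) / a) - Γ ((s - 1 / 2) / a)‖ ≤ |C| * (1 / a) ^ α * |t - s| ^ β := by
    intro s t hts
    rcases eq_or_ne s t with rfl | hst
    · rw [sub_self, norm_zero]
      positivity
    have hts0 : 0 < |t - s| := abs_pos.2 (sub_ne_zero.2 hst.symm)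
    have e : (t - 1 / 2) / a - (s - 1 / 2) / a = 1 / a * (t - s) := by ring
    refine (hC _ _ fun h => hst ?_).trans ?_
    · rw [div_left_inj' ha.ne'] at h
      linarith
    · rw [e, abs_mul, abs_of_pos (by positivity : 0 < 1 / a),
        Real.mul_rpow (by positivity) hts0.le, ← mul_assoc]
      have h1 : |t - s| ^ α ≤ |t - s| ^ β := Real.rpow_le_rpow_of_exponent_ge hts0 hts hβα.le
      have h2 := le_abs_self C
      gcongr
  obtain ⟨φ, X, H₀, D, ρ, hH₀, hD, hρ0, hρ1, hφ, hφ0, hφ1, hX1, hhol₀, hrate⟩ :=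
    exists_lift_unitInterval hβ0 (hβα.trans hα1).le hK0 hK hK' (by positivity)
      (fun x => Γ ((x - 1 / 2) / a)) hγ0 hγ
  set H := H₀ ⊔ 1 with hH
  have hH1 : 1 ≤ H := le_max_right _ _
  have hhol : ∀ m w, w.length ≤ K + 1 → ∀ t s : ℝ,
      |iterInt (φ m) w t s| ≤ (H * |t - s| ^ β) ^ w.length := fun m w hw t s =>
    (hhol₀ m w hw t s).trans (by gcongr; exact le_max_left _ _)
  have hlim : ∀ w : List (Fin d), w.length ≤ K + 1 → ∀ t s : ℝ,
      Filter.Tendsto (fun m => iterInt (φ m) w t s) Filter.atTop (nhds (X w t s)) := by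
    intro w hw t s
    have hDρ : Filter.Tendsto (fun m : ℕ => D * ρ ^ m) Filter.atTop (nhds 0) := by
      simpa using (tendsto_pow_atTop_nhds_zero_of_lt_one hρ0 hρ1).const_mul D
    exact tendsto_iff_dist_tendsto_zero.2
      (squeeze_zero (fun _ => dist_nonneg) (fun m => hrate m w hw t s) hDρ)
  have hXhol : ∀ w : List (Fin d), w.length ≤ K + 1 → ∀ t s : ℝ,
      |X w t s| ≤ (H * |t - s| ^ β) ^ w.length := fun w hw t s =>
    le_of_tendsto (hlim w hw t s).abs (Filter.Eventually.of_forall fun m => hhol m w hw t s)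
  have hXbdd : ∀ w : List (Fin d), w.length ≤ K + 1 → ∀ t s : ℝ, |X w t s| ≤ H ^ (K + 1) :=
    fun w hw t s => le_of_tendsto (hlim w hw t s).abs (Filter.Eventually.of_forall fun m =>
      abs_iterInt_le_of_holder (hφ m) (hφ0 m) hβ0.le hH1 (hhol m) w hw t s)
  have hscale : ∀ t s : ℝ, |a * t + 1 / 2 - (a * s + 1 / 2)| ≤ |t - s| := fun t s => by
    rw [add_sub_add_right_eq_sub, ← mul_sub, abs_mul, abs_of_pos ha]
    exact mul_le_of_le_one_left (abs_nonneg _) ha1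
  have hscale' : ∀ (t s : ℝ) (n : ℕ), (H * |a * t + 1 / 2 - (a * s + 1 / 2)| ^ β) ^ n ≤
      H ^ n * |t - s| ^ ((n : ℝ) * β) := fun t s n => by
    rw [mul_comm (n : ℝ), Real.rpow_mul (abs_nonneg _), Real.rpow_natCast, ← mul_pow]
    have := hscale t s
    gcongr
  refine ⟨fun m x => a • φ m (a * x + 1 / 2), fun m t i => iterInt (φ m) [i] (a * t + 1 / 2) 0,
    fun w t s => X w (a * t + 1 / 2) (a * s + 1 / 2), fun m => ?_,
    fun m => (primitive_properties (hφ m) (hφ0 m) (hφ1 m) ha).2.2, fun m => ?_, fun i t s => ?_,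
    fun w hw => ⟨⟨H ^ (K + 1), fun s t hst => ?_⟩, fun t s => ?_, fun hw0 ε hε => ?_⟩⟩
  · have := hφ m
    fun_prop
  · exact ⟨(primitive_properties (hφ m) (hφ0 m) (hφ1 m) ha).1,
      (primitive_properties (hφ m) (hφ0 m) (hφ1 m) ha).2.1⟩
  · refine (hX1 i _ _).trans ?_
    simp only [add_sub_cancel_right, mul_div_cancel_left₀ _ ha.ne']
  · have hts : 0 < |t - s| := abs_pos.2 (sub_ne_zero.2 hst.symm)
    rcases le_total |t - s| 1 with h | h
    · refine ((hXhol w (hw.trans hN) _ _).trans (hscale' t s _)).trans ?_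
      have h1 : |t - s| ^ ((w.length : ℝ) * β) ≤ |t - s| ^ ((w.length : ℝ) * α') :=
        Real.rpow_le_rpow_of_exponent_ge hts h (by gcongr)
      have h2 : H ^ w.length ≤ H ^ (K + 1) := pow_le_pow_right₀ hH1 (hw.trans hN)
      gcongr
    · refine (hXbdd w (hw.trans hN) _ _).trans (le_mul_of_one_le_right (by positivity) ?_)
      exact Real.one_le_rpow h (by positivity)
  · simp only [iterInt_comp_affine]
    exact hlim w (hw.trans hN) _ _
  · simp only [iterInt_comp_affine]
    have hpos : (0 : ℝ) < w.length := by exact_mod_cast List.length_pos_iff.2 hw0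
    refine exists_forall_abs_sub_le_rpow
      (a := fun m t s => iterInt (φ m) w (a * t + 1 / 2) (a * s + 1 / 2))
      (b := fun t s => X w (a * t + 1 / 2) (a * s + 1 / 2)) (θ := w.length * β)
      (C := 2 * H ^ w.length) (by gcongr) (by positivity) hD hρ0 hρ1 (by positivity)
      (fun m t s => ?_) (fun m t s => hrate m w (hw.trans hN) _ _) hε
    have h1 := (hhol m w (hw.trans hN) _ _).trans (hscale' t s w.length)
    have h2 := (hXhol w (hw.trans hN) _ _).trans (hscale' t s w.length)
    refine (abs_sub _ _).trans ?_
    linarith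

lemma chenMul_ofFn {n : ℕ} (hn : n ≠ 0) (w : Fin n → Fin d) (g h : List (Fin d) → ℝ) :
    chenMul g h (List.ofFn w) = g [] * h (List.ofFn w) +
      ∑ k ∈ Finset.univ.filter (fun k : Fin n => 0 < k.1),
        g (List.ofFn fun j : Fin k.1 => w ⟨j.1, j.2.trans k.2⟩) *
          h (List.ofFn fun j : Fin (n - k.1) => w ⟨k.1 + j.1, Nat.add_lt_of_lt_sub' j.2⟩) +
      g (List.ofFn w) * h [] := by
  have hlast : (List.ofFn w).take n = List.ofFn w := List.take_of_length_le (by simp)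
  have hlast' : (List.ofFn w).drop n = [] := List.drop_of_length_le (by simp)
  have htake : ∀ k : Fin n, List.ofFn (fun j : Fin k.1 => w ⟨j.1, j.2.trans k.2⟩) =
      (List.ofFn w).take k.1 := fun k =>
    List.ext_getElem (by simp [k.2.le]) fun i _ _ => by simp
  have hdrop : ∀ k : Fin n, List.ofFn (fun j : Fin (n - k.1) =>
      w ⟨k.1 + j.1, Nat.add_lt_of_lt_sub' j.2⟩) = (List.ofFn w).drop k.1 := fun k =>
    List.ext_getElem (by simp) fun i _ _ => by simp
  simp only [htake, hdrop]
  rw [chenMul, List.length_ofFn, Finset.sum_range_succ, hlast, hlast', Finset.sum_filter,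
    Fin.sum_univ_eq_sum_range (fun k => if 0 < k then
      g ((List.ofFn w).take k) * h ((List.ofFn w).drop k) else 0) n]
  obtain ⟨n, rfl⟩ := Nat.exists_eq_succ_of_ne_zero hn
  rw [Finset.sum_range_succ', Finset.sum_range_succ']
  simp [add_comm]

end Main

/-- **Corollary**: every compactly supported α-Hölder path may be lifted to a strong
α'-Hölder geometric rough path for any α' < α, i.e. to a geometric rough path which is a
limit of canonical lifts of smooth paths in the α'-Hölder norms. -/
theorem lift_to_strong_geometric_rough_path
    (α α' : ℝ) (hα0 : 0 < α) (hα1 : α < 1) (hα'0 : 0 < α') (hα'α : α' < α)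
    (N : ℕ) (hN : N = ⌊1 / α'⌋₊) (d : ℕ) (hd : 1 ≤ d)
    (Γ : ℝ → Fin d → ℝ) (hsupp : HasCompactSupport Γ)
    (hHolder : ∃ C : ℝ, ∀ s t : ℝ, s ≠ t → ‖Γ t - Γ s‖ ≤ C * |t - s| ^ α) :
    ∃ (X : (n : ℕ) → (Fin n → Fin d) → ℝ → ℝ → ℝ) (Γseq : ℕ → ℝ → Fin d → ℝ),
      -- (a) X is an α'-Hölder geometric rough path over Γ :
      -- level one consists of the increments of Γ
      (∀ (i : Fin d) (t s : ℝ), X 1 (fun _ => i) t s = Γ t i - Γ s i) ∧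
      -- Hölder continuity with exponents nα'
      (∀ n : ℕ, 1 ≤ n → n ≤ N → ∀ w : Fin n → Fin d,
        ∃ C : ℝ, ∀ s t : ℝ, s ≠ t → |X n w t s| ≤ C * |t - s| ^ ((n : ℝ) * α')) ∧
      -- multiplicative/Chen property
      (∀ n : ℕ, 2 ≤ n → n ≤ N → ∀ (w : Fin n → Fin d) (t u s : ℝ),
        X n w t s - X n w t u - X n w u s =
          ∑ k ∈ Finset.univ.filter (fun k : Fin n => 0 < k.1),
            X k.1 (fun j => w ⟨j.1, by have h1 := j.isLt; have h2 := k.isLt; omega⟩) t u *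
              X (n - k.1)
                (fun j => w ⟨k.1 + j.1, by have h1 := j.isLt; have h2 := k.isLt; omega⟩) u s) ∧
      -- geometric/shuffle property
      (∀ n₁ n₂ : ℕ, 1 ≤ n₁ → 1 ≤ n₂ → n₁ + n₂ ≤ N →
        ∀ (u : Fin n₁ → Fin d) (v : Fin n₂ → Fin d) (t s : ℝ),
          X n₁ u t s * X n₂ v t s =
            ∑ S : {S : Finset (Fin (n₁ + n₂)) // S.card = n₁},
              X (n₁ + n₂) (shuffleWord u v S.1 S.2) t s) ∧
      -- (b) X is the limit of canonical lifts of C¹ compactly supported paths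
      -- in the α'-Hölder norms
      (∀ m : ℕ, ContDiff ℝ 1 (Γseq m) ∧ HasCompactSupport (Γseq m)) ∧
      (∀ n : ℕ, 1 ≤ n → n ≤ N → ∀ w : Fin n → Fin d, ∀ ε : ℝ, 0 < ε → ∃ M : ℕ,
        ∀ m : ℕ, M ≤ m → ∀ s t : ℝ, s ≠ t →
          |canoLift (Γseq m) n w t s - X n w t s| ≤ ε * |t - s| ^ ((n : ℝ) * α')) := by
  obtain ⟨ψ, Γseq, X, hψ, hΓψ, hΓ, hX1, hX⟩ :=
    exists_smooth_approximation hα1 hα'0 hα'α Γ hsupp hHolder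
  rw [← hN] at hX
  have hnil : ∀ t s, X [] t s = 1 := fun t s =>
    tendsto_nhds_unique ((hX [] (by simp)).2.1 t s) (by simp)
  refine ⟨fun n w => X (List.ofFn w), Γseq, fun i t s => by simpa using hX1 i t s,
    fun n _ hn w => by simpa using (hX (List.ofFn w) (by simpa using hn)).1,
    fun n hn2 hn w t u s => ?_, fun n₁ n₂ _ _ hn u v t s => ?_, hΓ, fun n hn1 hn w ε hε => ?_⟩
  · have hchen : X (List.ofFn w) t s =
        chenMul (fun v => X v t u) (fun v => X v u s) (List.ofFn w) := by
      refine tendsto_nhds_unique ((hX (List.ofFn w) (by simpa using hn)).2.1 t s) ?_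
      simp only [iterInt_chen (hψ _) _ t u s]
      refine tendsto_finsetSum _ fun k _ => ?_
      exact ((hX _ (by simp; omega)).2.1 t u).mul ((hX _ (by simp; omega)).2.1 u s)
    rw [chenMul_ofFn (by omega), hnil, hnil, one_mul, mul_one] at hchen
    linarith
  · refine tendsto_nhds_unique (((hX (List.ofFn u) (by simp; omega)).2.1 t s).mul
      ((hX (List.ofFn v) (by simp; omega)).2.1 t s)) ?_
    simp only [iterInt_shuffleWord (hψ _)]
    exact tendsto_finsetSum _ fun S _ => (hX _ (by simpa using hn)).2.1 t s
  · simp only [canoLift_eq_iterInt, hΓψ]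
    simpa using (hX (List.ofFn w) (by simpa using hn)).2.2
      (by simpa using (by omega : n ≠ 0)) ε hε
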